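/- arXiv:2501.07098 — 11 statements merged into one kernel-verified Lean document; each statement's English description precedes it below -/
import Mathlib

section
/- Let (X,d) be a finite metric space that embeds isometrically into some Euclidean space, i.e. there exist n and a map f : X → ℝⁿ with (∑_{i=1}^n |f(x)_i − f(y)_i|²)^{1/2} = d(x,y) for all x,y ∈ X. Then (X,d) is ℓ₁-embeddable, i.e. there exist m and a map g : X → ℝᵐ with ∑_{i=1}^m |g(x)_i − g(y)_i| = d(x,y) for all x,y ∈ X. -/
open MeasureTheory in
/-- Partition the measure space according to the order in which the functions `h x` take their
values; on each piece `|h x - h y|` integrates to the absolute difference of the integrals. -/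
theorem exists_l1_map_of_integral_abs_sub {X Ω : Type*} [Fintype X] [MeasurableSpace Ω]
    (μ : Measure Ω) (h : X → Ω → ℝ) (hm : ∀ x, Measurable (h x))
    (hi : ∀ x, Integrable (h x) μ) :
    ∃ (m : ℕ) (g : X → Fin m → ℝ),
      ∀ x y : X, ∫ u, |h x u - h y u| ∂μ = ∑ i, |g x i - g y i| := by
  classical
  let P := X → X → Prop
  let e : P ≃ Fin (Fintype.card P) := Fintype.equivFin P
  let A : P → Set Ω := fun p => {u | ∀ x y, (h x u ≤ h y u ↔ p x y)}
  have hA : ∀ p, MeasurableSet (A p) := by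
    intro p
    simp only [A, Set.ofPred_forall]
    refine MeasurableSet.iInter fun x => MeasurableSet.iInter fun y => ?_
    by_cases hp : p x y
    · simpa [hp] using measurableSet_le (hm x) (hm y)
    · simpa [hp] using measurableSet_lt (hm y) (hm x)
  have hdisj : Pairwise (Function.onFun Disjoint A) := by
    intro p q hpq
    refine Set.disjoint_left.2 fun u hu hv => hpq ?_
    funext x y
    exact propext ((hu x y).symm.trans (hv x y))
  have hcover : ⋃ p, A p = Set.univ :=
    Set.eq_univ_of_forall fun u =>
      Set.mem_iUnion.2 ⟨fun x y => h x u ≤ h y u, fun _ _ => Iff.rfl⟩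
  refine ⟨Fintype.card P, fun x i => ∫ u in A (e.symm i), h x u ∂μ, fun x y => ?_⟩
  have hsub : Integrable (fun u => |h x u - h y u|) μ := ((hi x).sub (hi y)).abs
  rw [e.symm.sum_comp fun p => |(∫ u in A p, h x u ∂μ) - ∫ u in A p, h y u ∂μ|,
    ← setIntegral_univ, ← hcover, integral_iUnion_fintype hA hdisj
      fun p => hsub.integrableOn]
  refine Finset.sum_congr rfl fun p _ => ?_
  rw [← integral_sub (hi x).integrableOn (hi y).integrableOn]
  by_cases hp : p x y
  · have hle : ∀ u ∈ A p, h x u - h y u ≤ 0 := fun u hu => sub_nonpos.2 ((hu x y).2 hp)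
    rw [abs_of_nonpos (setIntegral_nonpos (hA p) hle), ← integral_neg]
    exact setIntegral_congr_fun (hA p) fun u hu => abs_of_nonpos (hle u hu)
  · have hge : ∀ u ∈ A p, 0 ≤ h x u - h y u := fun u hu =>
      sub_nonneg.2 (le_of_not_ge fun hle => hp ((hu x y).1 hle))
    rw [abs_of_nonneg (setIntegral_nonneg (hA p) hge)]
    exact setIntegral_congr_fun (hA p) fun u hu => abs_of_nonneg (hge u hu)

open MeasureTheory in
/-- By rotation invariance, the mean of `|⟪v, u⟫|` over the unit ball is proportional to `‖v‖`. -/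
theorem exists_integral_ball_abs_inner_eq (E : Type*) [NormedAddCommGroup E]
    [InnerProductSpace ℝ E] [FiniteDimensional ℝ E] [MeasurableSpace E] [BorelSpace E] :
    ∃ c : ℝ, 0 < c ∧ ∀ v : E, ∫ u in Metric.ball (0 : E) 1, |inner ℝ v u| = c * ‖v‖ := by
  rcases subsingleton_or_nontrivial E with hE | hE
  · exact ⟨1, one_pos, fun v => by simp [Subsingleton.elim v 0]⟩
  obtain ⟨e, he⟩ := exists_norm_eq E zero_le_one
  refine ⟨∫ u in Metric.ball (0 : E) 1, |inner ℝ e u|, ?_, fun v => ?_⟩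
  · have hc : Continuous fun u : E => |inner ℝ e u| := by fun_prop
    rw [setIntegral_pos_iff_support_of_nonneg_ae
      (Filter.Eventually.of_forall fun u => abs_nonneg _)
      ((hc.continuousOn.integrableOn_compact (isCompact_closedBall 0 1)).mono_set
        Metric.ball_subset_closedBall)]
    refine (hc.isOpen_support.inter Metric.isOpen_ball).measure_pos _
      ⟨(1 / 2 : ℝ) • e, ?_, ?_⟩
    · simp [inner_smul_right, he]
    · simp [norm_smul, he]
      norm_num
  · have hnorm : ‖v‖ = ‖‖v‖ • e‖ := by simp [norm_smul, he]
    let R : E ≃ₗᵢ[ℝ] E := (ℝ ∙ (v - ‖v‖ • e))ᗮ.reflection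
    have hR : R v = ‖v‖ • e := Submodule.reflection_sub hnorm
    have hpre : R ⁻¹' Metric.ball (0 : E) 1 = Metric.ball 0 1 := by
      ext u
      simp
    have key := R.measurePreserving.setIntegral_preimage_emb
      R.toHomeomorph.measurableEmbedding (fun u => |inner ℝ (R v) u|) (Metric.ball (0 : E) 1)
    simp only [hpre, R.inner_map_map] at key
    rw [key, hR, ← integral_mul_const]
    simp only [inner_smul_left, abs_mul, RCLike.conj_to_real, abs_norm, mul_comm]


/-- A finite metric space that embeds isometrically into some Euclidean
space (with the `ℓ₂` distance) is `ℓ₁`-embeddable. -/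
theorem euclidean_embeddable_implies_l1_embeddable
    (X : Type*) [Fintype X] [MetricSpace X]
    (h : ∃ (n : ℕ) (f : X → Fin n → ℝ),
      ∀ x y : X, dist x y = Real.sqrt (∑ i, |f x i - f y i| ^ 2)) :
    ∃ (m : ℕ) (g : X → Fin m → ℝ),
      ∀ x y : X, dist x y = ∑ i, |g x i - g y i| := by

  obtain ⟨n, f, hf⟩ := h
  obtain ⟨c, hc, hint⟩ := exists_integral_ball_abs_inner_eq (EuclideanSpace ℝ (Fin n))
  let F : X → EuclideanSpace ℝ (Fin n) := fun x => WithLp.toLp 2 (f x)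
  have hcont : ∀ x, Continuous fun u => inner ℝ (F x) u := fun x => by fun_prop
  obtain ⟨m, g, hg⟩ := exists_l1_map_of_integral_abs_sub
    (MeasureTheory.volume.restrict (Metric.ball (0 : EuclideanSpace ℝ (Fin n)) 1))
    (fun x u => inner ℝ (F x) u) (fun x => (hcont x).measurable)
    (fun x => ((hcont x).continuousOn.integrableOn_compact (isCompact_closedBall 0 1)).mono_set
      Metric.ball_subset_closedBall)
  refine ⟨m, fun x i => c⁻¹ * g x i, fun x y => ?_⟩
  have hdist : dist x y = ‖F x - F y‖ := by
    rw [hf, EuclideanSpace.norm_eq]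
    simp [F]
  have h := hg x y
  simp only [← inner_sub_left, hint] at h
  simp only [← mul_sub, abs_mul, abs_of_pos (inv_pos.2 hc), ← Finset.mul_sum]
  rw [← h, hdist, inv_mul_cancel_left₀ hc.ne']
end

section
/- Let (X,d) be a finite metric space that is ℓ₁-embeddable. Then (X,d) has negative type. -/
/-- The real line has negative type. -/
theorem sum_mul_abs_sub_nonpos {ι : Type*} [Fintype ι] (f ω : ι → ℝ) (hω : ∑ i, ω i = 0) :
    ∑ i, ∑ j, ω i * ω j * |f i - f j| ≤ 0 := by
  obtain ⟨c, hc⟩ := (Set.finite_range f).bddBelow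
  replace hc (i : ι) : c ≤ f i := hc ⟨i, rfl⟩
  have hpos := (MeasureTheory.posSemidef_matrix_measure_inter (μ := MeasureTheory.volume)
    (s := fun i ↦ Set.Ioc c (f i)) (fun _ ↦ measurableSet_Ioc)
    fun _ ↦ measure_Ioc_lt_top.ne).dotProduct_mulVec_nonneg ω
  have habs (i j : ι) : ω i * ω j * |f i - f j| = ω i * (f i - c) * ω j + ω i * (ω j * (f j - c))
      - 2 * (ω i *
        (MeasureTheory.volume.real (Set.Ioc c (f i) ∩ Set.Ioc c (f j)) * ω j)) := by
    rw [Set.Ioc_inter_Ioc, sup_idem, Real.volume_real_Ioc_of_le (le_min (hc i) (hc j)),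
      ← max_sub_min_eq_abs']
    linear_combination ω i * ω j * max_add_min (f i) (f j)
  simp only [dotProduct, Matrix.mulVec, Pi.star_apply, star_trivial, Matrix.of_apply] at hpos
  simp_rw [habs, Finset.sum_sub_distrib, Finset.sum_add_distrib,
    ← Finset.mul_sum, ← Finset.sum_mul, hω]
  linarith

/-- A finite metric space that is `ℓ₁`-embeddable has negative type. -/
theorem l1_embeddable_implies_negative_type
    (X : Type*) [Fintype X] [MetricSpace X]
    (h : ∃ (m : ℕ) (g : X → Fin m → ℝ),
      ∀ x y : X, dist x y = ∑ i, |g x i - g y i|) :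
    ∀ ω : X → ℝ, (∑ x, ω x) = 0 →
      (∑ x, ∑ y, ω x * ω y * dist x y) ≤ 0 := by
  obtain ⟨m, g, hg⟩ := h
  intro ω hω
  calc
    ∑ x, ∑ y, ω x * ω y * dist x y = ∑ i, ∑ x, ∑ y, ω x * ω y * |g x i - g y i| := by
      simp_rw [hg, Finset.mul_sum]
      simp_rw [Finset.sum_comm (s := Finset.univ (α := X)) (t := Finset.univ (α := Fin m))]
    _ ≤ 0 := Finset.sum_nonpos fun i _ ↦ sum_mul_abs_sub_nonpos (g · i) ω hω
end

section
/- Let (X,d) be a finite metric space. Then (X,d) has negative type if and only if the square-root metric space (X,√d) is Euclidean-embeddable, i.e. there exist n and a map f : X → ℝⁿ with (∑_{i=1}^n |f(x)_i − f(y)_i|²)^{1/2} = √(d(x,y)) for all x,y ∈ X. -/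
open Finset Matrix in
/-- If a symmetric kernel `d` vanishing on the diagonal is of negative type, its Gram kernel
based at a point `o` is positive semidefinite. -/
theorem posSemidef_gram_of_negative_type {X : Type*} [Fintype X] (d : X → X → ℝ)
    (hsymm : ∀ x y, d x y = d y x) (hself : ∀ x, d x x = 0)
    (h : ∀ ω : X → ℝ, ∑ x, ω x = 0 → ∑ x, ∑ y, ω x * ω y * d x y ≤ 0) (o : X) :
    (Matrix.of fun x y => (d x o + d y o - d x y) / 2).PosSemidef := by
  classical
  refine PosSemidef.of_dotProduct_mulVec_nonneg ?_ fun w => ?_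
  · ext x y
    simp [hsymm y x, add_comm]
  · have hω := h (fun x => w x - if x = o then ∑ z, w z else 0) (by simp)
    have hexp : ∑ x, ∑ y, (w x - if x = o then ∑ z, w z else 0) *
          (w y - if y = o then ∑ z, w z else 0) * d x y =
        ∑ x, ∑ y, w x * w y * d x y - 2 * ((∑ z, w z) * ∑ x, w x * d x o) := by
      simp only [sub_mul, mul_sub, sum_sub_distrib, ite_mul, mul_ite, zero_mul, mul_zero,
        sum_ite_eq', mem_univ, if_true, sum_ite_irrel, sum_const_zero, hself, hsymm o]
      simp only [mul_right_comm _ (∑ z, w z), mul_assoc (∑ z, w z), ← sum_mul, ← mul_sum]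
      ring
    have hgram : star w ⬝ᵥ ((Matrix.of fun x y => (d x o + d y o - d x y) / 2) *ᵥ w) =
        (∑ z, w z) * (∑ x, w x * d x o) - (∑ x, ∑ y, w x * w y * d x y) / 2 := by
      have hterm : ∀ x y, w x * ((d x o + d y o - d x y) / 2 * w y) =
          (w x * d x o) * w y / 2 + w x * (w y * d y o) / 2 - w x * w y * d x y / 2 := by
        intro x y
        ring
      simp only [dotProduct, mulVec, Pi.star_apply, star_trivial, of_apply, mul_sum, hterm,
        sum_sub_distrib, sum_add_distrib, ← sum_div]
      simp only [← mul_sum, ← sum_mul]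
      ring
    rw [hgram]
    linarith [hexp ▸ hω]

open Finset in
/-- For weights of total zero, the quadratic form of a squared difference kernel is
minus twice a square. -/
theorem sum_mul_mul_sub_sq_of_sum_eq_zero {X : Type*} [Fintype X] (ω g : X → ℝ)
    (hω : ∑ x, ω x = 0) :
    ∑ x, ∑ y, ω x * ω y * (g x - g y) ^ 2 = -2 * (∑ x, ω x * g x) ^ 2 := by
  have hterm : ∀ x y, ω x * ω y * (g x - g y) ^ 2 =
      (ω x * g x ^ 2) * ω y + ω x * (ω y * g y ^ 2) - 2 * ((ω x * g x) * (ω y * g y)) := by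
    intro x y
    ring
  simp only [hterm, sum_sub_distrib, sum_add_distrib, ← mul_sum, ← sum_mul, hω]
  ring

/-- A finite metric space `(X,d)` has negative type if and only if
`(X,√d)` embeds isometrically into some Euclidean space. -/
theorem negative_type_iff_sqrt_euclidean_embeddable
    (X : Type*) [Fintype X] [MetricSpace X] :
    (∀ ω : X → ℝ, (∑ x, ω x) = 0 →
        (∑ x, ∑ y, ω x * ω y * dist x y) ≤ 0) ↔
      (∃ (n : ℕ) (f : X → Fin n → ℝ),
        ∀ x y : X, Real.sqrt (∑ i, |f x i - f y i| ^ 2) = Real.sqrt (dist x y)) := by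
  constructor
  · intro h
    rcases isEmpty_or_nonempty X with hX | ⟨⟨o⟩⟩
    · exact ⟨0, fun _ _ => 0, fun x => hX.elim x⟩
    obtain ⟨n, v, hv⟩ := Matrix.posSemidef_iff_eq_sum_vecMulVec.mp
      (posSemidef_gram_of_negative_type dist dist_comm dist_self h o)
    have hgram : ∀ x y, (dist x o + dist y o - dist x y) / 2 = ∑ i, v i x * v i y := by
      intro x y
      simpa [Matrix.sum_apply, Matrix.vecMulVec_apply] using congrFun (congrFun hv x) y
    refine ⟨n, fun x i => v i x, fun x y => congrArg Real.sqrt ?_⟩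
    have hterm : ∀ i, |v i x - v i y| ^ 2 =
        v i x * v i x + v i y * v i y - 2 * (v i x * v i y) := by
      intro i
      rw [sq_abs]
      ring
    simp only [hterm, Finset.sum_sub_distrib, Finset.sum_add_distrib, ← Finset.mul_sum,
      ← hgram, dist_self]
    ring
  · rintro ⟨n, f, hf⟩ ω hω
    have hdist : ∀ x y, dist x y = ∑ i, (f x i - f y i) ^ 2 := by
      intro x y
      have := (Real.sqrt_inj (Finset.sum_nonneg fun i _ => by positivity) dist_nonneg).mp (hf x y)
      simpa only [sq_abs] using this.symm
    have hsum : ∑ x, ∑ y, ω x * ω y * dist x y =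
        ∑ i, ∑ x, ∑ y, ω x * ω y * (f x i - f y i) ^ 2 := by
      simp only [hdist, Finset.mul_sum]
      rw [Finset.sum_comm]
      simp only [Finset.sum_comm (t := (Finset.univ : Finset (Fin n)))]
      exact Finset.sum_congr rfl fun i _ => Finset.sum_comm
    rw [hsum]
    refine Finset.sum_nonpos fun i _ => ?_
    rw [sum_mul_mul_sub_sq_of_sum_eq_zero ω (fun x => f x i) hω]
    nlinarith [sq_nonneg (∑ x, ω x * f x i)]
end

section
/- Let (X,d) be a finite metric space with at least two points that has negative type. Then the distance matrix of (X,d) (the real symmetric matrix D indexed by X with entries D(x,y) = d(x,y)) has exactly one positive eigenvalue, counted with multiplicity. -/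
open Matrix in
/-- The eigenvectors of a real symmetric matrix are orthonormal for the dot product. -/
lemma Matrix.IsHermitian.eigenvectorBasis_dotProduct {n : Type*} [Fintype n] [DecidableEq n]
    {A : Matrix n n ℝ} (hA : A.IsHermitian) (i j : n) :
    (hA.eigenvectorBasis i : n → ℝ) ⬝ᵥ (hA.eigenvectorBasis j : n → ℝ) =
      if i = j then 1 else 0 := by
  have h := orthonormal_iff_ite.mp hA.eigenvectorBasis.orthonormal i j
  rw [← h, EuclideanSpace.inner_eq_star_dotProduct, dotProduct_comm]
  simp

open Matrix in
/-- The quadratic form of a real symmetric matrix on the span of two distinct eigenvectors. -/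
lemma Matrix.IsHermitian.dotProduct_mulVec_eigenvectorBasis_add {n : Type*} [Fintype n]
    [DecidableEq n] {A : Matrix n n ℝ} (hA : A.IsHermitian) {i j : n} (hij : i ≠ j) (c d : ℝ) :
    (c • (hA.eigenvectorBasis i : n → ℝ) + d • (hA.eigenvectorBasis j : n → ℝ)) ⬝ᵥ
      A *ᵥ (c • (hA.eigenvectorBasis i : n → ℝ) + d • (hA.eigenvectorBasis j : n → ℝ)) =
      c ^ 2 * hA.eigenvalues i + d ^ 2 * hA.eigenvalues j := by
  simp only [mulVec_add, mulVec_smul, hA.mulVec_eigenvectorBasis, add_dotProduct, dotProduct_add,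
    smul_dotProduct, dotProduct_smul, hA.eigenvectorBasis_dotProduct, hij, hij.symm, smul_eq_mul,
    if_true, if_false]
  ring

open Matrix in
/-- A real symmetric matrix whose quadratic form is nonpositive on the vectors with zero sum has
at most one positive eigenvalue, counted with multiplicity. -/
lemma Matrix.IsHermitian.card_pos_eigenvalues_le_one {n : Type*} [Fintype n] [DecidableEq n]
    {A : Matrix n n ℝ} (hA : A.IsHermitian)
    (h : ∀ v : n → ℝ, ∑ x, v x = 0 → v ⬝ᵥ A *ᵥ v ≤ 0) :
    (Finset.univ.filter fun i => 0 < hA.eigenvalues i).card ≤ 1 := by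
  refine Finset.card_le_one.mpr fun i hi j hj => ?_
  simp only [Finset.mem_filter, Finset.mem_univ, true_and] at hi hj
  by_contra hij
  obtain ⟨c, d, hsum, hcd⟩ : ∃ c d : ℝ, c * ∑ x, hA.eigenvectorBasis i x +
      d * ∑ x, hA.eigenvectorBasis j x = 0 ∧ (c ≠ 0 ∨ d ≠ 0) := by
    by_cases ha : ∑ x, hA.eigenvectorBasis i x = 0
    · exact ⟨1, 0, by simp [ha], by simp⟩
    · exact ⟨∑ x, hA.eigenvectorBasis j x, -∑ x, hA.eigenvectorBasis i x, by ring,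
        Or.inr (neg_ne_zero.mpr ha)⟩
  have hq := h (c • (hA.eigenvectorBasis i : n → ℝ) + d • (hA.eigenvectorBasis j : n → ℝ))
    (by simpa [Finset.sum_add_distrib, Finset.mul_sum] using hsum)
  rw [hA.dotProduct_mulVec_eigenvectorBasis_add hij] at hq
  rcases hcd with hc | hd
  · have : 0 < c ^ 2 * hA.eigenvalues i := by positivity
    have : 0 ≤ d ^ 2 * hA.eigenvalues j := by positivity
    linarith
  · have : 0 ≤ c ^ 2 * hA.eigenvalues i := by positivity
    have : 0 < d ^ 2 * hA.eigenvalues j := by positivity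
    linarith

/-- A nonzero real symmetric matrix with zero trace has a positive eigenvalue. -/
lemma Matrix.IsHermitian.exists_pos_eigenvalue_of_trace_eq_zero {n : Type*} [Fintype n]
    [DecidableEq n] {A : Matrix n n ℝ} (hA : A.IsHermitian) (htr : A.trace = 0) (hne : A ≠ 0) :
    ∃ i, 0 < hA.eigenvalues i := by
  by_contra! hle
  have hsum : ∑ i, hA.eigenvalues i = 0 := by
    simpa [htr] using hA.trace_eq_sum_eigenvalues.symm
  refine hne (hA.eigenvalues_eq_zero_iff.mp (funext fun i => ?_))
  exact (Finset.sum_eq_zero_iff_of_nonpos fun i _ => hle i).mp hsum i (Finset.mem_univ i)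

/-- If a finite metric space with at least two points has negative type,
then its distance matrix has exactly one positive eigenvalue (with multiplicity). -/
theorem negative_type_distance_matrix_one_positive_eigenvalue
    (X : Type*) [Fintype X] [DecidableEq X] [MetricSpace X]
    (hcard : 1 < Fintype.card X)
    (hneg : ∀ ω : X → ℝ, (∑ x, ω x) = 0 →
      (∑ x, ∑ y, ω x * ω y * dist x y) ≤ 0)
    (hD : (Matrix.of fun x y : X => (dist x y : ℝ)).IsHermitian) :
    (Finset.univ.filter fun i : X => 0 < hD.eigenvalues i).card = 1 := by
  refine le_antisymm (hD.card_pos_eigenvalues_le_one fun v hv => ?_) (Finset.card_pos.mpr ?_)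
  · convert hneg v hv using 1
    simp only [dotProduct, Matrix.mulVec, Matrix.of_apply, Finset.mul_sum]
    exact Finset.sum_congr rfl fun x _ => Finset.sum_congr rfl fun y _ => by ring
  · obtain ⟨i, hi⟩ := hD.exists_pos_eigenvalue_of_trace_eq_zero (by simp [Matrix.trace]) fun h => by
      obtain ⟨x, y, hxy⟩ := Fintype.one_lt_card_iff.mp hcard
      exact hxy (dist_eq_zero.mp (congrFun (congrFun h x) y))
    exact ⟨i, by simpa using hi⟩
end

section
/- Let G be a finite connected simple graph. The following are equivalent: (1) for every positive edge-weighting w : E(G) → ℝ_{>0}, the shortest-path metric d_w on the vertices of G (where d_w(x,y) is the minimum over all paths from x to y of the sum of the weights of their edges) is ℓ₁-embeddable; (2) G does not contain K_{2,3} as a minor. -/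
/-- `H` is a minor of `G`: there is a family of pairwise disjoint nonempty connected
branch sets in `G`, one for each vertex of `H`, with an edge of `G` between the branch
sets of any two adjacent vertices of `H`. -/
def SimpleGraph.HasMinor {V W : Type*} (G : SimpleGraph V) (H : SimpleGraph W) : Prop :=
  ∃ B : W → Set V,
    (∀ w, (G.induce (B w)).Connected) ∧
    (Pairwise fun w₁ w₂ => Disjoint (B w₁) (B w₂)) ∧
    (∀ w₁ w₂, H.Adj w₁ w₂ → ∃ a ∈ B w₁, ∃ b ∈ B w₂, G.Adj a b)

/-- The shortest-path metric on the vertices of `G` induced by an edge-weighting `w`: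
the minimum (infimum) over all paths from `x` to `y` of the total weight of their edges. -/
noncomputable def SimpleGraph.weightedDist {V : Type*} (G : SimpleGraph V)
    (w : Sym2 V → ℝ) (x y : V) : ℝ :=
  sInf {r : ℝ | ∃ p : G.Path x y, r = ((p : G.Walk x y).edges.map w).sum}

/-- A function `d` on pairs of points is realised as an `ℓ₁` distance. -/
def IsL1 {X : Type*} (d : X → X → ℝ) : Prop :=
  ∃ (ι : Type) (_ : Fintype ι) (g : X → ι → ℝ), ∀ x y, d x y = ∑ i, |g x i - g y i|

namespace IsL1

variable {X Y : Type*}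

theorem comap {d : X → X → ℝ} (hd : IsL1 d) (f : Y → X) : IsL1 fun x y => d (f x) (f y) := by
  obtain ⟨ι, _, g, hg⟩ := hd
  exact ⟨ι, inferInstance, fun x => g (f x), fun x y => hg _ _⟩

theorem add {d d' : X → X → ℝ} (hd : IsL1 d) (hd' : IsL1 d') :
    IsL1 fun x y => d x y + d' x y := by
  obtain ⟨ι, _, g, hg⟩ := hd
  obtain ⟨ι', _, g', hg'⟩ := hd'
  refine ⟨ι ⊕ ι', inferInstance, fun x => Sum.elim (g x) (g' x), fun x y => ?_⟩
  simp [hg, hg']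

theorem exists_fin {d : X → X → ℝ} (hd : IsL1 d) :
    ∃ (m : ℕ) (g : X → Fin m → ℝ), ∀ x y, d x y = ∑ i, |g x i - g y i| := by
  obtain ⟨ι, _, g, hg⟩ := hd
  refine ⟨Fintype.card ι, fun x i => g x ((Fintype.equivFin ι).symm i), fun x y => ?_⟩
  rw [hg]
  exact ((Fintype.equivFin ι).symm.sum_comp fun i => |g x i - g y i|).symm

end IsL1

/-- The pentagonal inequality on the real line. -/
theorem pentagonal_inequality (a b c s t : ℝ) :
    |a - b| + |a - c| + |b - c| + |s - t| ≤
      |s - a| + |s - b| + |s - c| + (|t - a| + |t - b| + |t - c|) := by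
  have key : ∀ a b c : ℝ, a ≤ b → b ≤ c → |a - b| + |a - c| + |b - c| + |s - t| ≤
      |s - a| + |s - b| + |s - c| + (|t - a| + |t - b| + |t - c|) := by
    intro a b c hab hbc
    have h₁ := abs_sub_le s b t
    have h₂ := abs_sub_le a s c
    have h₃ := abs_sub_le a t c
    rw [abs_sub_comm b t] at h₁
    rw [abs_sub_comm a s] at h₂
    rw [abs_sub_comm a t] at h₃
    have h₄ : |a - b| + |b - c| = |a - c| := by
      rw [abs_of_nonpos (by linarith), abs_of_nonpos (by linarith), abs_of_nonpos (by linarith)]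
      ring
    linarith
  have hab := abs_sub_comm a b
  have hac := abs_sub_comm a c
  have hbc := abs_sub_comm b c
  rcases le_total a b with h₁ | h₁ <;> rcases le_total b c with h₂ | h₂ <;>
    rcases le_total a c with h₃ | h₃
  · linarith [key a b c h₁ h₂]
  · linarith [key a b c h₁ h₂]
  · linarith [key a c b h₃ h₂]
  · linarith [key c a b h₃ h₁]
  · linarith [key b a c h₁ h₃]
  · linarith [key b c a h₂ h₃]
  · linarith [key c b a h₂ h₁]
  · linarith [key c b a h₂ h₁]

theorem IsL1.pentagonal {X : Type*} {d : X → X → ℝ} (hd : IsL1 d) (a b c s t : X) :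
    d a b + d a c + d b c + d s t ≤ d s a + d s b + d s c + (d t a + d t b + d t c) := by
  obtain ⟨ι, _, g, hg⟩ := hd
  simp only [hg, ← Finset.sum_add_distrib]
  exact Finset.sum_le_sum fun i _ => pentagonal_inequality _ _ _ _ _

section Kalmanson

open Finset

theorem sum_rect_mixed_difference (D : ℕ → ℕ → ℝ) {a b c e : ℕ} (hab : a ≤ b) (hce : c ≤ e) :
    ∑ p ∈ Ico a b, ∑ q ∈ Ico c e, (D p q + D (p + 1) (q + 1) - D p (q + 1) - D (p + 1) q) =
      D a c + D b e - D a e - D b c := by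
  have inner : ∀ p, ∑ q ∈ Ico c e, (D p q + D (p + 1) (q + 1) - D p (q + 1) - D (p + 1) q) =
      D p c + D (p + 1) e - D p e - D (p + 1) c := by
    intro p
    induction e, hce using Nat.le_induction with
    | base => simp
    | succ e hce ih => rw [sum_Ico_succ_top hce, ih]; ring
  simp only [inner]
  induction b, hab using Nat.le_induction with
  | base => simp
  | succ b hab ih => rw [sum_Ico_succ_top hab, ih]; ring

/-- A symmetric function on a cyclically ordered set of `n` points whose mixed differences are
nonnegative is an `ℓ₁` distance: it is a nonnegative combination of the cuts of the cyclic order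
into two arcs. -/
theorem exists_l1_of_mixed_difference_nonneg (D : ℕ → ℕ → ℝ) (n : ℕ)
    (self : ∀ i, D i i = 0) (symm : ∀ i j, D i j = D j i) (per : ∀ i, D i n = D i 0)
    (nonneg : ∀ p q, p < q → q < n → 0 ≤ D p q + D (p + 1) (q + 1) - D p (q + 1) - D (p + 1) q) :
    ∃ g : ℕ → Fin n × Fin n → ℝ, ∀ i < n, ∀ j < n, D i j = ∑ k, |g i k - g j k| := by
  set A : ℕ → ℕ → ℝ := fun p q => D p q + D (p + 1) (q + 1) - D p (q + 1) - D (p + 1) q with hA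
  let g : ℕ → ℕ → ℕ → ℝ := fun x p q => if p < x ∧ x ≤ q then A p q / 2 else 0
  have main : ∀ i j, i ≤ j → j < n →
      D i j = ∑ p ∈ range n, ∑ q ∈ range n, |g i p q - g j p q| := by
    intro i j hij hj
    have split : ∀ p ∈ range n, ∀ q ∈ range n, |g i p q - g j p q| =
        (if p ∈ Ico 0 i then if q ∈ Ico i j then A p q / 2 else 0 else 0) +
        (if p ∈ Ico i j then if q ∈ Ico j n then A p q / 2 else 0 else 0) := by
      intro p hp q hq
      simp only [mem_range] at hp hq
      simp only [g, mem_Ico]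
      by_cases hpq : p < q
      · have h0 : 0 ≤ A p q / 2 := by have := nonneg p q hpq hq; simp only [hA]; linarith
        split_ifs <;> first | omega | simp [abs_of_nonneg h0]
      · split_ifs <;> first | omega | simp
    have rect : ∀ a b c e, b ≤ n → e ≤ n → ∑ p ∈ range n, ∑ q ∈ range n,
        (if p ∈ Ico a b then if q ∈ Ico c e then A p q / 2 else 0 else 0) =
        (∑ p ∈ Ico a b, ∑ q ∈ Ico c e, A p q) / 2 := by
      intro a b c e hb he
      have hs : ∀ a b, b ≤ n → range n ∩ Ico a b = Ico a b := by
        intro a b hb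
        apply inter_eq_right.2
        intro x
        simp only [mem_Ico, mem_range]
        omega
      have : ∀ p ∈ range n, ∑ q ∈ range n,
          (if p ∈ Ico a b then if q ∈ Ico c e then A p q / 2 else 0 else 0) =
          if p ∈ Ico a b then ∑ q ∈ Ico c e, A p q / 2 else 0 := by
        intro p _
        split_ifs
        · rw [sum_ite_mem, hs _ _ he]
        · simp
      rw [sum_congr rfl this, sum_ite_mem, hs _ _ hb]
      simp only [sum_div]
    rw [sum_congr rfl fun p hp => sum_congr rfl (split p hp)]
    simp only [sum_add_distrib]
    rw [rect _ _ _ _ (by omega) (by omega), rect _ _ _ _ (by omega) (by omega)]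
    simp only [hA]
    rw [sum_rect_mixed_difference D (Nat.zero_le _) hij, sum_rect_mixed_difference D hij hj.le]
    simp only [self, per]
    rw [symm 0 i, symm 0 j]
    ring
  refine ⟨fun x k => g x k.1 k.2, fun i hi j hj => ?_⟩
  rw [Fintype.sum_prod_type]
  simp only [Finset.sum_range] at main
  rcases le_total i j with h | h
  · exact main i j h hj
  · rw [symm, main j i h hi]
    simp only [abs_sub_comm]

/-- Kalmanson's condition on a cyclic order implies `ℓ₁`-embeddability. -/
theorem isL1_of_kalmanson {X : Type*} (d : X → X → ℝ) (self : ∀ x, d x x = 0)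
    (symm : ∀ x y, d x y = d y x) (tri : ∀ x y z, d x z ≤ d x y + d y z) (l : List X)
    (hl : ∀ x, x ∈ l)
    (kal : ∀ a b c e, List.Sublist [a, b, c, e] l →
      d a b + d c e ≤ d a c + d b e ∧ d a e + d b c ≤ d a c + d b e) : IsL1 d := by
  classical
  rcases isEmpty_or_nonempty X with hX | ⟨⟨x₀⟩⟩
  · exact ⟨Empty, inferInstance, fun x => hX.elim x, fun x => hX.elim x⟩
  have hn : 0 < l.length := List.length_pos_of_mem (hl x₀)
  let v : ℕ → X := fun i => l[i % l.length]'(Nat.mod_lt _ hn)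
  have kal' : ∀ i j k m, i < j → j < k → k < m → m < l.length →
      d (v i) (v j) + d (v k) (v m) ≤ d (v i) (v k) + d (v j) (v m) ∧
      d (v i) (v m) + d (v j) (v k) ≤ d (v i) (v k) + d (v j) (v m) := by
    intro i j k m hij hjk hkm hm
    apply kal
    have h := List.map_getElem_sublist (l := l)
      (is := [⟨i, by omega⟩, ⟨j, by omega⟩, ⟨k, by omega⟩, ⟨m, hm⟩]) (by
        simp only [List.pairwise_cons, List.mem_cons, List.not_mem_nil, or_false, forall_eq_or_imp,
          forall_eq, Fin.mk_lt_mk]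
        simp
        omega)
    simp only [List.map_cons, List.map_nil, Fin.getElem_fin] at h
    simp only [v, Nat.mod_eq_of_lt hm, Nat.mod_eq_of_lt (show i < l.length by omega),
      Nat.mod_eq_of_lt (show j < l.length by omega), Nat.mod_eq_of_lt (show k < l.length by omega)]
    exact h
  have vn : v l.length = v 0 := by simp [v]
  obtain ⟨g, hg⟩ := exists_l1_of_mixed_difference_nonneg (fun i j => d (v i) (v j)) l.length
    (fun i => self _) (fun i j => symm _ _) (fun i => by simp only [vn]) (by
      intro p q hpq hq
      rcases Nat.lt_or_ge (q + 1) l.length with h | h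
      · rcases Nat.lt_or_ge (p + 1) q with h' | h'
        · linarith [(kal' p (p + 1) q (q + 1) (by omega) h' (by omega) h).2,
            (kal' p (p + 1) q (q + 1) (by omega) h' (by omega) h).1]
        · obtain rfl : q = p + 1 := by omega
          linarith [tri (v p) (v (p + 1)) (v (p + 1 + 1)), self (v (p + 1))]
      · have hq1 : q + 1 = l.length := by omega
        rw [hq1, vn]
        rcases Nat.eq_zero_or_pos p with rfl | hp
        · linarith [tri (v 1) (v 0) (v q), self (v 0)]
        · rcases Nat.lt_or_ge (p + 1) q with h' | h'
          · have := (kal' 0 p (p + 1) q hp (by omega) h' hq).1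
            linarith [symm (v 0) (v (p + 1)), symm (v 0) (v p)]
          · obtain rfl : q = p + 1 := by omega
            linarith [tri (v p) (v (p + 1)) (v 0), self (v (p + 1))])
  refine ⟨Fin l.length × Fin l.length, inferInstance, fun x => g (l.idxOf x), fun x y => ?_⟩
  have hv : ∀ x, v (l.idxOf x) = x := by
    intro x
    have : l.idxOf x < l.length := List.idxOf_lt_length_of_mem (hl x)
    simp [v, Nat.mod_eq_of_lt this]
  have := hg (l.idxOf x) (List.idxOf_lt_length_of_mem (hl x)) (l.idxOf y)
    (List.idxOf_lt_length_of_mem (hl y))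
  rwa [hv, hv] at this

end Kalmanson

/-- Four points can always be cyclically ordered so that Kalmanson's condition holds. -/
theorem isL1_of_card_le_four {X : Type*} (d : X → X → ℝ) (self : ∀ x, d x x = 0)
    (symm : ∀ x y, d x y = d y x) (tri : ∀ x y z, d x z ≤ d x y + d y z) (l : List X)
    (hl : ∀ x, x ∈ l) (hlen : l.length ≤ 4) : IsL1 d := by
  rcases hlen.lt_or_eq with h | h
  · exact isL1_of_kalmanson d self symm tri l hl fun a b c e hs =>
      absurd hs.length_le (by simp; omega)
  · obtain ⟨a, b, c, e, rfl⟩ : ∃ a b c e, l = [a, b, c, e] := by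
      match l, h with
      | [a, b, c, e], _ => exact ⟨a, b, c, e, rfl⟩
    have key : ∀ a b c e, (∀ x, x ∈ [a, b, c, e]) → d a b + d c e ≤ d a c + d b e →
        d a e + d b c ≤ d a c + d b e → IsL1 d := by
      intro a b c e hm h₁ h₂
      refine isL1_of_kalmanson d self symm tri _ hm fun a' b' c' e' hs => ?_
      have := hs.eq_of_length (by simp)
      simp only [List.cons.injEq, and_true] at this
      obtain ⟨rfl, rfl, rfl, rfl⟩ := this
      exact ⟨h₁, h₂⟩
    have hbc := symm b c
    have hce := symm c e
    have hbe := symm b e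
    by_cases h₁ : d a b + d c e ≤ d a c + d b e ∧ d a e + d b c ≤ d a c + d b e
    · exact key a b c e hl h₁.1 h₁.2
    · by_cases h₂ : d a c + d b e ≤ d a b + d c e ∧ d a e + d b c ≤ d a b + d c e
      · exact key a c b e (fun x => by have := hl x; simp at this ⊢; tauto) h₂.1
          (by rw [← hbc]; exact h₂.2)
      · have h₃ : d a b + d c e ≤ d a e + d b c ∧ d a c + d b e ≤ d a e + d b c := by
          grind
        exact key a b e c (fun x => by have := hl x; simp at this ⊢; tauto)
          (by rw [← hce]; exact h₃.1) h₃.2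

namespace SimpleGraph

variable {V : Type*} {G : SimpleGraph V}

/-- `d` is a pseudometric on the vertices of `G` such that any two vertices are joined by a walk
all of whose vertices lie metrically between them. -/
structure IsGeodesicMetric (G : SimpleGraph V) (d : V → V → ℝ) : Prop where
  self : ∀ x, d x x = 0
  symm : ∀ x y, d x y = d y x
  tri : ∀ x y z, d x z ≤ d x y + d y z
  walk : ∀ x y, ∃ p : G.Walk x y, ∀ z ∈ p.support, d x z + d z y = d x y

section WeightedDist

variable {w : Sym2 V → ℝ}

theorem Walk.sum_weight_nonneg (hw : ∀ e ∈ G.edgeSet, 0 < w e) {x y : V} (p : G.Walk x y) :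
    0 ≤ (p.edges.map w).sum := by
  apply List.sum_nonneg
  simp only [List.mem_map, forall_exists_index, and_imp, forall_apply_eq_imp_iff₂]
  exact fun e he => (hw e (p.edges_subset_edgeSet he)).le

theorem bddBelow_path_weights (hw : ∀ e ∈ G.edgeSet, 0 < w e) (x y : V) :
    BddBelow {r : ℝ | ∃ p : G.Path x y, r = ((p : G.Walk x y).edges.map w).sum} := by
  refine ⟨0, ?_⟩
  rintro _ ⟨p, rfl⟩
  exact (p : G.Walk x y).sum_weight_nonneg hw

theorem weightedDist_le_walk (hw : ∀ e ∈ G.edgeSet, 0 < w e) {x y : V} (p : G.Walk x y) :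
    G.weightedDist w x y ≤ (p.edges.map w).sum := by
  classical
  refine (csInf_le (bddBelow_path_weights hw x y) ⟨⟨p.bypass, p.bypass_isPath⟩, rfl⟩).trans ?_
  apply (p.edges_bypass_sublist_edges.map w).sum_le_sum
  simp only [List.mem_map, forall_exists_index, and_imp, forall_apply_eq_imp_iff₂]
  exact fun e he => (hw e (p.edges_subset_edgeSet he)).le

theorem exists_walk_weight_eq [Finite V] (hconn : G.Connected) (w : Sym2 V → ℝ) (x y : V) :
    ∃ p : G.Walk x y, G.weightedDist w x y = (p.edges.map w).sum := by
  classical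
  have := Fintype.ofFinite V
  obtain ⟨q⟩ := hconn x y
  have hne : {r : ℝ | ∃ p : G.Path x y, r = ((p : G.Walk x y).edges.map w).sum}.Nonempty :=
    ⟨_, ⟨q.bypass, q.bypass_isPath⟩, rfl⟩
  have hfin : {r : ℝ | ∃ p : G.Path x y, r = ((p : G.Walk x y).edges.map w).sum}.Finite := by
    refine (Set.finite_range fun p : G.Path x y => ((p : G.Walk x y).edges.map w).sum).subset ?_
    rintro _ ⟨p, rfl⟩
    exact ⟨p, rfl⟩
  obtain ⟨p, hp⟩ := hne.csInf_mem hfin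
  exact ⟨p, hp⟩

theorem isGeodesicMetric_weightedDist [Finite V] (hconn : G.Connected)
    (hw : ∀ e ∈ G.edgeSet, 0 < w e) : G.IsGeodesicMetric (G.weightedDist w) := by
  classical
  have tri : ∀ x y z, G.weightedDist w x z ≤ G.weightedDist w x y + G.weightedDist w y z := by
    intro x y z
    obtain ⟨p, hp⟩ := exists_walk_weight_eq hconn w x y
    obtain ⟨q, hq⟩ := exists_walk_weight_eq hconn w y z
    have := weightedDist_le_walk hw (p.append q)
    rw [Walk.edges_append, List.map_append, List.sum_append] at this
    linarith
  have symm_le : ∀ x y, G.weightedDist w x y ≤ G.weightedDist w y x := by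
    intro x y
    obtain ⟨p, hp⟩ := exists_walk_weight_eq hconn w y x
    have := weightedDist_le_walk hw p.reverse
    rwa [Walk.edges_reverse, List.map_reverse, List.sum_reverse, ← hp] at this
  refine ⟨fun x => ?_, fun x y => (symm_le x y).antisymm (symm_le y x), tri, fun x y => ?_⟩
  · obtain ⟨p, hp⟩ := exists_walk_weight_eq hconn w x x
    refine le_antisymm ?_ (hp ▸ p.sum_weight_nonneg hw)
    simpa using weightedDist_le_walk hw (Walk.nil : G.Walk x x)
  · obtain ⟨p, hp⟩ := exists_walk_weight_eq hconn w x y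
    refine ⟨p, fun z hz => (tri x z y).antisymm' ?_⟩
    have h₁ := weightedDist_le_walk hw (p.takeUntil z hz)
    have h₂ := weightedDist_le_walk hw (p.dropUntil z hz)
    have h₃ := congrArg (fun q => (q.edges.map w).sum) (p.take_spec hz)
    simp only [Walk.edges_append, List.map_append, List.sum_append] at h₃
    linarith

end WeightedDist

section Minor

theorem Walk.sub_le_sum_weight {w : Sym2 V → ℝ} (f : V → ℝ)
    (hf : ∀ x y, G.Adj x y → f y - f x ≤ w s(x, y)) {x y : V} (p : G.Walk x y) :
    f y - f x ≤ (p.edges.map w).sum := by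
  induction p with
  | nil => simp
  | cons h p ih =>
    simp only [Walk.edges_cons, List.map_cons, List.sum_cons]
    linarith [hf _ _ h]

/-- Distances in `K_{2,3}`, extended by zero to an additional point. -/
def distK23 : Option (Fin 2 ⊕ Fin 3) → Option (Fin 2 ⊕ Fin 3) → ℕ
  | none, _ => 0
  | _, none => 0
  | some (.inl i), some (.inl j) => if i = j then 0 else 2
  | some (.inr i), some (.inr j) => if i = j then 0 else 2
  | some (.inl _), some (.inr _) => 1
  | some (.inr _), some (.inl _) => 1

/-- Edge lengths on a graph labelled by the branch sets of a `K_{2,3}` minor. -/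
noncomputable def weightK23 (ε : ℝ) (a b : Option (Fin 2 ⊕ Fin 3)) : ℝ :=
  if a = none ∨ b = none then 2 else if a = b then ε else distK23 a b

theorem exists_weight_not_isL1 [Fintype V] (hconn : G.Connected)
    (h : G.HasMinor (completeBipartiteGraph (Fin 2) (Fin 3))) :
    ∃ w : Sym2 V → ℝ, (∀ e ∈ G.edgeSet, 0 < w e) ∧ ¬ IsL1 (G.weightedDist w) := by
  classical
  obtain ⟨B, hB, hdisj, hadj⟩ := h
  let L : V → Option (Fin 2 ⊕ Fin 3) := fun v => if h : ∃ i, v ∈ B i then some h.choose else none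
  have hL : ∀ i, ∀ v ∈ B i, L v = some i := by
    intro i v hv
    have h : ∃ i, v ∈ B i := ⟨i, hv⟩
    simp only [L, h, dif_pos, Option.some.injEq]
    by_contra hne
    exact Set.disjoint_left.1 (hdisj hne) h.choose_spec hv
  have hcard : (0 : ℝ) < Fintype.card V := by
    have := hconn.nonempty
    exact_mod_cast Fintype.card_pos
  set ε : ℝ := 1 / (12 * Fintype.card V + 1) with hε
  have hε0 : 0 < ε := by positivity
  have hεc : 12 * (Fintype.card V * ε) < 1 := by
    rw [hε, mul_one_div, mul_div_assoc', div_lt_one (by positivity)]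
    linarith
  have hsymm : ∀ a b, weightK23 ε a b = weightK23 ε b a := by
    intro a b
    rcases a with _ | (a | a) <;> rcases b with _ | (b | b) <;>
      simp [weightK23, distK23, eq_comm]
  have hpos : ∀ a b, 0 < weightK23 ε a b := by
    intro a b
    unfold weightK23
    split_ifs with h₁ h₂
    · norm_num
    · exact hε0
    · have : 0 < distK23 a b := by
        revert a b
        decide
      exact_mod_cast this
  have hlip : ∀ c a b, (distK23 c b : ℝ) - distK23 c a ≤ weightK23 ε a b := by
    intro c a b
    unfold weightK23
    split_ifs with h₁ h₂
    · have : distK23 c b ≤ 2 := by revert a b c; decide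
      have : (distK23 c b : ℝ) ≤ 2 := by exact_mod_cast this
      linarith [(distK23 c a).cast_nonneg (α := ℝ)]
    · rw [h₂]
      linarith
    · have : distK23 c b ≤ distK23 c a + distK23 a b := by
        clear h₂
        revert a b c
        decide
      have : (distK23 c b : ℝ) ≤ distK23 c a + distK23 a b := by exact_mod_cast this
      linarith
  let w : Sym2 V → ℝ := Sym2.lift ⟨fun x y => weightK23 ε (L x) (L y), fun x y => hsymm _ _⟩
  have hw : ∀ e ∈ G.edgeSet, 0 < w e := by
    intro e
    induction e with
    | _ x y => exact fun _ => hpos _ _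
  refine ⟨w, hw, fun hL1 => ?_⟩
  have lower : ∀ x y, (distK23 (L x) (L y) : ℝ) ≤ G.weightedDist w x y := by
    intro x y
    obtain ⟨p, hp⟩ := exists_walk_weight_eq hconn w x y
    rw [hp]
    have hself : distK23 (L x) (L x) = 0 := by
      rcases L x with _ | (a | a) <;> simp [distK23]
    have := p.sub_le_sum_weight (w := w) (fun z => (distK23 (L x) (L z) : ℝ))
      (fun a b _ => hlip _ _ _)
    simpa [hself] using this
  have geo := isGeodesicMetric_weightedDist hconn hw
  have within : ∀ i, ∀ x ∈ B i, ∀ y ∈ B i, G.weightedDist w x y ≤ Fintype.card V * ε := by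
    intro i x hx y hy
    obtain ⟨q, hq⟩ := ((hB i).preconnected ⟨x, hx⟩ ⟨y, hy⟩).exists_isPath
    let p : G.Walk x y := q.map (Embedding.induce (B i)).toHom
    have hp : p.IsPath := hq.map Subtype.val_injective
    refine (weightedDist_le_walk hw p).trans ?_
    have hpe : p.edges = q.edges.map (Sym2.map (Embedding.induce (B i)).toHom) :=
      Walk.edges_map _ _
    have hle : ∀ r ∈ p.edges.map w, r ≤ ε := by
      rw [hpe]
      simp only [List.map_map, List.mem_map, forall_exists_index, and_imp]
      rintro _ e - rfl
      induction e with
      | _ a b =>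
        change weightK23 ε (L a) (L b) ≤ ε
        simp [weightK23, hL i a a.2, hL i b b.2]
    have := List.sum_le_card_nsmul _ _ hle
    rw [nsmul_eq_mul, List.length_map, Walk.length_edges] at this
    exact this.trans (mul_le_mul_of_nonneg_right (by exact_mod_cast hp.length_lt.le) hε0.le)
  have rep : ∀ i, ∃ x, x ∈ B i := fun i => by
    obtain ⟨x⟩ := (hB i).nonempty
    exact ⟨x, x.2⟩
  choose r hr using rep
  have upper : ∀ i j, G.weightedDist w (r (.inl i)) (r (.inr j)) ≤
      1 + 2 * (Fintype.card V * ε) := by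
    intro i j
    obtain ⟨a, ha, b, hb, hab⟩ := hadj (.inl i) (.inr j) (by simp)
    have h₁ := within _ _ (hr (.inl i)) _ ha
    have h₂ := within _ _ hb _ (hr (.inr j))
    have h₃ : G.weightedDist w a b ≤ 1 := by
      have : w s(a, b) = 1 := by
        change weightK23 ε (L a) (L b) = 1
        simp [weightK23, hL _ _ ha, hL _ _ hb, distK23]
      simpa [this] using weightedDist_le_walk hw hab.toWalk
    linarith [geo.tri (r (.inl i)) a (r (.inr j)), geo.tri a b (r (.inr j))]
  have lower' : ∀ i j, (distK23 (some i) (some j) : ℝ) ≤ G.weightedDist w (r i) (r j) := by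
    intro i j
    simpa [hL _ _ (hr i), hL _ _ (hr j)] using lower (r i) (r j)
  have key := hL1.pentagonal (r (.inr 0)) (r (.inr 1)) (r (.inr 2)) (r (.inl 0)) (r (.inl 1))
  have l₁ := lower' (.inr 0) (.inr 1)
  have l₂ := lower' (.inr 0) (.inr 2)
  have l₃ := lower' (.inr 1) (.inr 2)
  have l₄ := lower' (.inl 0) (.inl 1)
  simp [distK23] at l₁ l₂ l₃ l₄
  linarith [upper 0 0, upper 0 1, upper 0 2, upper 1 0, upper 1 1, upper 1 2]

end Minor

section Structure

theorem hasMinor_of_induce {W : Type*} {H : SimpleGraph W} (A : Set V)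
    (h : (G.induce A).HasMinor H) : G.HasMinor H := by
  obtain ⟨B, hB, hdisj, hadj⟩ := h
  refine ⟨fun i => Subtype.val '' B i, fun i => ?_, fun i j hij => ?_, fun i j hij => ?_⟩
  · let f : (G.induce A).induce (B i) →g G.induce (Subtype.val '' B i) :=
      ⟨fun x => ⟨x.1.1, x.1, x.2, rfl⟩, fun h => h⟩
    refine Connected.map f ?_ (hB i)
    rintro ⟨_, x, hx, rfl⟩
    exact ⟨⟨x, hx⟩, rfl⟩
  · exact (Set.disjoint_image_iff Subtype.val_injective).2 (hdisj hij)
  · obtain ⟨a, ha, b, hb, hab⟩ := hadj i j hij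
    exact ⟨a, ⟨a, ha, rfl⟩, b, ⟨b, hb, rfl⟩, hab⟩

theorem connected_induce_singleton (x : V) : (G.induce {x}).Connected := by
  rw [connected_iff]
  exact ⟨fun a b => by rw [Subsingleton.elim a b], ⟨⟨x, rfl⟩⟩⟩

/-- Two vertices together with three disjoint connected sets adjacent to both give a `K_{2,3}`
minor. -/
theorem hasMinor_K23_of_theta {x y : V} (hxy : x ≠ y) (S : Fin 3 → Set V)
    (hS : ∀ i, (G.induce (S i)).Connected) (hdisj : Pairwise fun i j => Disjoint (S i) (S j))
    (hx : ∀ i, x ∉ S i) (hy : ∀ i, y ∉ S i) (hxS : ∀ i, ∃ s ∈ S i, G.Adj x s)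
    (hyS : ∀ i, ∃ s ∈ S i, G.Adj y s) :
    G.HasMinor (completeBipartiteGraph (Fin 2) (Fin 3)) := by
  have adj : ∀ i j, ∃ s ∈ S j, G.Adj (![x, y] i) s := by
    intro i j
    fin_cases i
    · exact hxS j
    · exact hyS j
  have notMem : ∀ i j, ![x, y] i ∉ S j := by
    intro i j
    fin_cases i
    · exact hx j
    · exact hy j
  refine ⟨Sum.elim (fun i => {![x, y] i}) S, ?_, ?_, ?_⟩
  · rintro (i | i)
    · exact connected_induce_singleton _
    · exact hS i
  · rintro (i | i) (j | j) hij
    · simp only [Sum.elim_inl, Set.disjoint_singleton]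
      fin_cases i <;> fin_cases j <;> simp_all [hxy.symm]
    · simpa using notMem i j
    · simpa using notMem j i
    · exact hdisj (by simpa using hij)
  · rintro (i | i) (j | j) hij
    · simp at hij
    · obtain ⟨s, hs, h⟩ := adj i j
      exact ⟨_, rfl, s, hs, h⟩
    · obtain ⟨s, hs, h⟩ := adj j i
      exact ⟨s, hs, _, rfl, h.symm⟩
    · simp at hij

theorem connected_induce_of_isChain {l : List V} (hl : l ≠ []) (h : l.IsChain G.Adj) :
    (G.induce {z | z ∈ l}).Connected := by
  have := (Walk.ofSupport l hl h).connected_induce_support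
  rwa [Walk.support_ofSupport] at this

theorem exists_adj_of_isChain_cons_append {x : V} {l t : List V} (hl : l ≠ [])
    (h : (x :: (l ++ t)).IsChain G.Adj) : ∃ s ∈ l, G.Adj x s := by
  obtain ⟨a, l, rfl⟩ := List.exists_cons_of_ne_nil hl
  simp only [List.cons_append, List.isChain_cons_cons] at h
  exact ⟨a, by simp, h.1⟩

theorem exists_adj_of_isChain_append_cons {y : V} {l t : List V} (hl : l ≠ [])
    (h : (l ++ y :: t).IsChain G.Adj) : ∃ s ∈ l, G.Adj y s := by
  obtain ⟨l, a, rfl⟩ := (List.eq_nil_or_concat' l).resolve_left hl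
  rw [List.append_assoc, List.singleton_append, List.isChain_append_cons_cons] at h
  exact ⟨a, by simp, h.2.1.symm⟩

/-- `l` lists the vertices of a cycle of `G`; a single edge counts as a cycle. -/
def IsCycleList (G : SimpleGraph V) (l : List V) : Prop :=
  l.Nodup ∧ (l : Cycle V).Chain G.Adj

theorem IsCycleList.isRotated {l l' : List V} (h : G.IsCycleList l) (hr : l ~r l') :
    G.IsCycleList l' :=
  ⟨hr.nodup_iff.1 h.1, Cycle.coe_eq_coe.2 hr ▸ h.2⟩

theorem isRotated_cons_append_cons (x y : V) (l₁ l₂ : List V) :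
    x :: (l₁ ++ y :: l₂) ~r y :: (l₂ ++ x :: l₁) := by
  have := List.isRotated_append (l := x :: l₁) (l' := y :: l₂)
  simpa using this

/-- `G` has no vertex `v` separating a set `S` from the other vertices. -/
def NoCutVertex (G : SimpleGraph V) : Prop :=
  ∀ (v : V) (S : Set V), v ∉ S → S.Nonempty → (∀ a ∈ S, ∀ b ∉ S, G.Adj a b → b = v) →
    ∀ y ∉ S, y = v

theorem exists_list_of_connected_induce {K : Set V} (hK : (G.induce K).Connected) {a b : V}
    (ha : a ∈ K) (hb : b ∈ K) : ∃ k : List V, k ≠ [] ∧ k.Nodup ∧ (∀ z ∈ k, z ∈ K) ∧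
      ∀ s t, G.Adj s a → G.Adj b t → (s :: (k ++ [t])).IsChain G.Adj := by
  obtain ⟨q, hq⟩ := (hK.preconnected ⟨a, ha⟩ ⟨b, hb⟩).exists_isPath
  let p : G.Walk a b := q.map (Embedding.induce K).toHom
  have hp : p.IsPath := hq.map Subtype.val_injective
  have hps : p.support = q.support.map (Embedding.induce K).toHom := Walk.support_map _ _
  refine ⟨p.support, p.support_ne_nil, hp.support_nodup, fun z hz => ?_, fun s t hs ht => ?_⟩
  · rw [hps, List.mem_map] at hz
    obtain ⟨z', -, rfl⟩ := hz
    exact z'.2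
  · have := ((p.concat ht).cons hs).isChain_adj_support
    rwa [Walk.support_cons, Walk.support_concat] at this

theorem IsCycleList.exists_longer (h2 : G.NoCutVertex)
    (hminor : ¬ G.HasMinor (completeBipartiteGraph (Fin 2) (Fin 3))) {l : List V}
    (hl : G.IsCycleList l) (hlen : 2 ≤ l.length) {v : V} (hv : v ∉ l) :
    ∃ l', G.IsCycleList l' ∧ l.length < l'.length := by
  classical
  let K : Set V := {z | ∃ p : G.Walk v z, ∀ u ∈ p.support, u ∉ l}
  have hvK : v ∈ K := ⟨Walk.nil, by simpa using hv⟩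
  have hKl : ∀ z ∈ K, z ∉ l := fun z ⟨p, hp⟩ => hp z p.end_mem_support
  have hleave : ∀ a ∈ K, ∀ b ∉ K, G.Adj a b → b ∈ l := by
    rintro a ⟨p, hp⟩ b hb hab
    by_contra hbl
    refine hb ⟨p.concat hab, fun u hu => ?_⟩
    rw [Walk.support_concat, List.mem_append, List.mem_singleton] at hu
    rcases hu with hu | rfl
    · exact hp u hu
    · exact hbl
  have hK : (G.induce K).Connected := by
    refine G.induce_connected_of_patches v hvK fun {z} hz => ?_
    obtain ⟨p, hp⟩ := hz
    refine ⟨{u | u ∈ p.support}, fun u hu => ?_, p.start_mem_support, p.end_mem_support,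
      p.connected_induce_support.preconnected _ _⟩
    exact ⟨p.takeUntil u hu, fun t ht => hp t (p.support_takeUntil_subset_support hu ht)⟩
  obtain ⟨c₁, c₂, t, rfl⟩ : ∃ c₁ c₂ t, l = c₁ :: c₂ :: t := by
    match l, hlen with
    | c₁ :: c₂ :: t, _ => exact ⟨c₁, c₂, t, rfl⟩
  have hc : c₁ ≠ c₂ := by
    have := hl.1
    simp only [List.nodup_cons, List.mem_cons, not_or] at this
    exact this.1.1
  have hc₁ : c₁ ∉ K := fun h => hKl _ h (by simp)
  have hc₂ : c₂ ∉ K := fun h => hKl _ h (by simp)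
  have hexit : ∀ u ∉ K, ∃ a ∈ K, ∃ b ∉ K, G.Adj a b ∧ b ≠ u := by
    intro u hu
    by_contra! hcon
    have := h2 u K hu ⟨v, hvK⟩ hcon
    exact hc ((this c₁ hc₁).trans (this c₂ hc₂).symm)
  obtain ⟨a, ha, x, hx, hax, -⟩ := hexit c₁ hc₁
  obtain ⟨b, hb, y, hy, hby, hyx⟩ := hexit x hx
  have hxl := hleave a ha x hx hax
  have hyl := hleave b hb y hy hby
  generalize c₁ :: c₂ :: t = l at hl hKl hxl hyl
  obtain ⟨s, t, rfl⟩ := List.append_of_mem hxl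
  have hrot : s ++ x :: t ~r x :: (t ++ s) := by
    have := List.isRotated_append (l := s) (l' := x :: t)
    simpa using this
  have hyl' : y ∈ t ++ s := by
    have := hrot.mem_iff.1 hyl
    simpa [hyx] using this
  obtain ⟨l₁, l₂, hl₁₂⟩ := List.append_of_mem hyl'
  rw [hl₁₂] at hrot
  rw [hrot.perm.length_eq]
  replace hl := hl.isRotated hrot
  replace hKl : ∀ z ∈ K, z ∉ x :: (l₁ ++ y :: l₂) := fun z hz h => hKl z hz (hrot.mem_iff.2 h)
  clear hrot hl₁₂ hyl' hyl hxl
  have extend : ∀ a b x y : V, ∀ l₁ : List V, a ∈ K → b ∈ K → G.Adj a x → G.Adj b y →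
      G.IsCycleList (x :: (l₁ ++ [y])) → (∀ z ∈ K, z ∉ x :: (l₁ ++ [y])) →
      ∃ l', G.IsCycleList l' ∧ (x :: (l₁ ++ [y])).length < l'.length := by
    intro a b x y l₁ ha hb hax hby hl hKl
    obtain ⟨k, hk₀, hk₁, hk₂, hk₃⟩ := exists_list_of_connected_induce hK hb ha
    refine ⟨x :: (l₁ ++ [y]) ++ k, ⟨?_, ?_⟩, ?_⟩
    · exact hl.1.append hk₁ fun z hz hz' => hKl z (hk₂ z hz') hz
    · have h₁ := hl.2
      have h₂ := hk₃ y x hby.symm hax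
      simp only [List.cons_append, Cycle.chain_coe_cons, List.append_assoc, List.nil_append] at h₁ ⊢
      rw [← List.cons_append, List.isChain_split] at h₁ ⊢
      exact ⟨h₁.1, h₂⟩
    · have := List.length_pos_iff.2 hk₀
      simp only [List.length_append]
      omega
  rcases eq_or_ne l₂ [] with rfl | h₂
  · exact extend a b x y l₁ ha hb hax hby hl hKl
  rcases eq_or_ne l₁ [] with rfl | h₁
  · have hr : x :: ([] ++ y :: l₂) ~r y :: (l₂ ++ [x]) := isRotated_cons_append_cons _ _ _ _
    rw [hr.perm.length_eq]
    exact extend b a y x l₂ hb ha hby hax (hl.isRotated hr) fun z hz h =>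
      hKl z hz (hr.mem_iff.2 h)
  · refine (hminor ?_).elim
    have hnd := hl.1
    have hch := hl.2
    have hyn : y ∉ l₁ ++ l₂ := (List.nodup_cons.1 (List.nodup_middle.1 hnd.of_cons)).1
    rw [Cycle.chain_coe_cons] at hch
    have hch₁ : (x :: (l₁ ++ [y])).IsChain G.Adj := hch.infix ⟨[], l₂ ++ [x], by simp⟩
    have hch₂ : (y :: (l₂ ++ [x])).IsChain G.Adj := hch.infix ⟨x :: l₁, [], by simp⟩
    refine hasMinor_K23_of_theta hyx.symm ![{z | z ∈ l₁}, {z | z ∈ l₂}, K] ?_ ?_ ?_ ?_ ?_ ?_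
    · intro i
      fin_cases i
      · exact connected_induce_of_isChain h₁ (hch₁.infix ⟨[x], [y], by simp⟩)
      · exact connected_induce_of_isChain h₂ (hch₂.infix ⟨[y], [x], by simp⟩)
      · exact hK
    · have h₁₂ : Disjoint {z | z ∈ l₁} {z | z ∈ l₂} := by
        rw [Set.disjoint_left]
        intro z hz hz'
        simp only [List.nodup_cons, List.nodup_append, List.mem_append, List.mem_cons] at hnd
        exact hnd.2.2.2 z hz z (Or.inr hz') rfl
      have h₁K : Disjoint {z | z ∈ l₁} K := by
        rw [Set.disjoint_left]
        intro z hz hz'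
        exact hKl z hz' (by simp_all)
      have h₂K : Disjoint {z | z ∈ l₂} K := by
        rw [Set.disjoint_left]
        intro z hz hz'
        exact hKl z hz' (by simp_all)
      intro i j hij
      fin_cases i <;> fin_cases j <;>
        first | exact absurd rfl hij | assumption | exact Disjoint.symm (by assumption)
    · intro i
      fin_cases i
      · exact fun h => by simp_all
      · exact fun h => by simp_all
      · exact hx
    · intro i
      fin_cases i
      · exact fun h => hyn (List.mem_append_left _ h)
      · exact fun h => hyn (List.mem_append_right _ h)
      · exact hy
    · intro i
      fin_cases i
      · exact exists_adj_of_isChain_cons_append h₁ hch₁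
      · exact exists_adj_of_isChain_append_cons (t := []) h₂ hch₂.tail
      · exact ⟨a, ha, hax.symm⟩
    · intro i
      fin_cases i
      · exact exists_adj_of_isChain_append_cons (t := []) h₁ hch₁.tail
      · exact exists_adj_of_isChain_cons_append h₂ hch₂
      · exact ⟨b, hb, hby.symm⟩

theorem exists_hamiltonian_cycleList [Fintype V] (h2 : G.NoCutVertex)
    (hminor : ¬ G.HasMinor (completeBipartiteGraph (Fin 2) (Fin 3))) {a b : V} (hab : G.Adj a b) :
    ∃ l, G.IsCycleList l ∧ ∀ x, x ∈ l := by
  have key : ∀ n, ∀ l, G.IsCycleList l → 2 ≤ l.length → Fintype.card V - l.length = n →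
      ∃ l, G.IsCycleList l ∧ ∀ x, x ∈ l := by
    intro n
    induction n using Nat.strong_induction_on with
    | _ n ih =>
      intro l hl hlen hn
      by_cases hall : ∀ x, x ∈ l
      · exact ⟨l, hl, hall⟩
      · push Not at hall
        obtain ⟨v, hv⟩ := hall
        obtain ⟨l', hl', hlt⟩ := hl.exists_longer h2 hminor hlen hv
        have := hl'.1.length_le_card
        exact ih _ (by omega) l' hl' (by omega) rfl
  refine key _ [a, b] ⟨by simp [hab.ne], ?_⟩ le_rfl rfl
  simp [hab, hab.symm]

theorem IsCycleList.hasMinor_of_crossing_of_ne_nil {a b c e : V} {l₁ l₂ l₃ l₄ : List V}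
    (hl : G.IsCycleList (a :: (l₁ ++ b :: (l₂ ++ c :: (l₃ ++ e :: l₄))))) (h₁ : l₁ ≠ [])
    (hac : G.Adj a c) (hbe : G.Adj b e) :
    G.HasMinor (completeBipartiteGraph (Fin 2) (Fin 3)) := by
  have hnd := hl.1
  have hch := hl.2
  rw [Cycle.chain_coe_cons] at hch
  have hch₁ : (a :: (l₁ ++ [b])).IsChain G.Adj :=
    hch.infix ⟨[], l₂ ++ c :: (l₃ ++ e :: l₄) ++ [a], by simp⟩
  have hch₂ : (b :: (l₂ ++ [c])).IsChain G.Adj :=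
    hch.infix ⟨a :: l₁, l₃ ++ e :: l₄ ++ [a], by simp⟩
  have hch₃ : ((l₃ ++ e :: l₄) ++ [a]).IsChain G.Adj :=
    hch.infix ⟨a :: (l₁ ++ b :: (l₂ ++ [c])), [], by simp⟩
  simp only [List.nodup_cons, List.nodup_append, List.mem_append, List.mem_cons, not_or] at hnd
  refine hasMinor_K23_of_theta (x := a) (y := b) (fun h => by simp_all)
    ![{z | z ∈ l₁}, {z | z ∈ l₂ ++ [c]}, {z | z ∈ l₃ ++ e :: l₄}] ?_ ?_ ?_ ?_ ?_ ?_
  · intro i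
    fin_cases i
    · exact connected_induce_of_isChain h₁ (hch₁.infix ⟨[a], [b], by simp⟩)
    · exact connected_induce_of_isChain (by simp) hch₂.tail
    · exact connected_induce_of_isChain (by simp) (hch₃.infix ⟨[], [a], by simp⟩)
  · have d₁ : Disjoint {z | z ∈ l₁} {z | z ∈ l₂ ++ [c]} := by
      rw [Set.disjoint_left]
      intro z hz hz'
      grind
    have d₂ : Disjoint {z | z ∈ l₁} {z | z ∈ l₃ ++ e :: l₄} := by
      rw [Set.disjoint_left]
      intro z hz hz'
      grind
    have d₃ : Disjoint {z | z ∈ l₂ ++ [c]} {z | z ∈ l₃ ++ e :: l₄} := by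
      rw [Set.disjoint_left]
      intro z hz hz'
      grind
    intro i j hij
    fin_cases i <;> fin_cases j <;>
      first | exact absurd rfl hij | assumption | exact Disjoint.symm (by assumption)
  · intro i
    fin_cases i <;> exact fun h => by simp_all
  · intro i
    fin_cases i
    · exact fun (h : b ∈ l₁) => by grind
    · exact fun h => by simp_all
    · exact fun h => by simp_all
  · intro i
    fin_cases i
    · exact exists_adj_of_isChain_cons_append h₁ hch₁
    · exact ⟨c, by simp, hac⟩
    · exact exists_adj_of_isChain_append_cons (by simp) hch₃
  · intro i
    fin_cases i
    · exact exists_adj_of_isChain_append_cons (t := []) h₁ hch₁.tail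
    · exact exists_adj_of_isChain_cons_append (t := []) (by simp) (by simpa using hch₂)
    · exact ⟨e, by simp, hbe⟩

/-- A cycle of length at least five with two crossing chords yields a `K_{2,3}` minor. -/
theorem IsCycleList.hasMinor_of_crossing {a b c e : V} {l₁ l₂ l₃ l₄ : List V}
    (hl : G.IsCycleList (a :: (l₁ ++ b :: (l₂ ++ c :: (l₃ ++ e :: l₄)))))
    (hlen : 5 ≤ (a :: (l₁ ++ b :: (l₂ ++ c :: (l₃ ++ e :: l₄)))).length)
    (hac : G.Adj a c) (hbe : G.Adj b e) :
    G.HasMinor (completeBipartiteGraph (Fin 2) (Fin 3)) := by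
  have rot : ∀ {a b c e : V} {l₁ l₂ l₃ l₄ : List V},
      G.IsCycleList (a :: (l₁ ++ b :: (l₂ ++ c :: (l₃ ++ e :: l₄)))) →
      G.IsCycleList (b :: (l₂ ++ c :: (l₃ ++ e :: (l₄ ++ a :: l₁)))) := by
    intro a b c e l₁ l₂ l₃ l₄ h
    simpa using h.isRotated (isRotated_cons_append_cons a b l₁ _)
  by_cases h₁ : l₁ = []
  · by_cases h₂ : l₂ = []
    · by_cases h₃ : l₃ = []
      · have h₄ : l₄ ≠ [] := by
          rintro rfl
          simp [h₁, h₂, h₃] at hlen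
        exact (rot (rot (rot hl))).hasMinor_of_crossing_of_ne_nil h₄ hbe.symm hac
      · exact (rot (rot hl)).hasMinor_of_crossing_of_ne_nil h₃ hac.symm hbe.symm
    · exact (rot hl).hasMinor_of_crossing_of_ne_nil h₂ hbe hac.symm
  · exact hl.hasMinor_of_crossing_of_ne_nil h₁ hac hbe

theorem exists_eq_append_of_cons_sublist {a : V} {k l : List V} (h : List.Sublist (a :: k) l) :
    ∃ s t, l = s ++ a :: t ∧ List.Sublist k t := by
  obtain ⟨r₁, r₂, rfl, ha, hk⟩ := List.cons_sublist_iff.1 h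
  obtain ⟨s, t, rfl⟩ := List.append_of_mem ha
  exact ⟨s, t ++ r₂, by simp, hk.trans (List.sublist_append_right _ _)⟩

theorem exists_adj_between_arcs {x y : V} {l₁ l₂ : List V}
    (hall : ∀ z, z ∈ x :: (l₁ ++ y :: l₂)) {u v : V} (q : G.Walk u v) (hu : u ∈ l₂) (hv : v ∉ l₂)
    (hx : x ∉ q.support) (hy : y ∉ q.support) :
    ∃ u' ∈ l₂, ∃ v' ∈ l₁, G.Adj u' v' ∧ u' ∈ q.support ∧ v' ∈ q.support := by
  obtain ⟨⟨⟨u', v'⟩, hadj⟩, hd, hu', hv'⟩ := q.exists_boundary_dart {z | z ∈ l₂} hu hv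
  have hu'q := q.dart_fst_mem_support_of_mem_darts hd
  have hv'q := q.dart_snd_mem_support_of_mem_darts hd
  refine ⟨u', hu', v', ?_, hadj, hu'q, hv'q⟩
  have hvx : v' ≠ x := fun h => hx (h ▸ hv'q)
  have hvy : v' ≠ y := fun h => hy (h ▸ hv'q)
  have := hall v'
  simp only [List.mem_cons, List.mem_append] at this
  rcases this with h | h | h | h
  · exact absurd h hvx
  · exact h
  · exact absurd h hvy
  · exact absurd h hv'

/-- Walks joining interlacing pairs of vertices of a Hamiltonian cycle meet. -/
theorem IsCycleList.exists_mem_support_inter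
    (hminor : ¬ G.HasMinor (completeBipartiteGraph (Fin 2) (Fin 3))) {l : List V}
    (hl : G.IsCycleList l) (hall : ∀ x, x ∈ l) (hlen : 5 ≤ l.length) {a b c e : V}
    (hs : List.Sublist [a, b, c, e] l) (p : G.Walk a c) (q : G.Walk b e) :
    ∃ z ∈ p.support, z ∈ q.support := by
  by_contra! hdisj
  apply hminor
  obtain ⟨l₀, t, rfl, hs₁⟩ := exists_eq_append_of_cons_sublist hs
  obtain ⟨l₁, t, rfl, hs₂⟩ := exists_eq_append_of_cons_sublist hs₁
  obtain ⟨l₂, t, rfl, hs₃⟩ := exists_eq_append_of_cons_sublist hs₂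
  obtain ⟨l₃, l₄, rfl, -⟩ := exists_eq_append_of_cons_sublist hs₃
  have hr : l₀ ++ a :: (l₁ ++ b :: (l₂ ++ c :: (l₃ ++ e :: l₄))) ~r
      b :: ((l₂ ++ c :: l₃) ++ e :: (l₄ ++ l₀ ++ a :: l₁)) := by
    have := List.isRotated_append (l := l₀ ++ a :: l₁) (l' := b :: (l₂ ++ c :: (l₃ ++ e :: l₄)))
    simpa using this
  replace hl := hl.isRotated hr
  replace hall : ∀ x, x ∈ b :: ((l₂ ++ c :: l₃) ++ e :: (l₄ ++ l₀ ++ a :: l₁)) :=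
    fun x => hr.mem_iff.1 (hall x)
  rw [hr.perm.length_eq] at hlen
  have hc : c ∉ l₄ ++ l₀ ++ a :: l₁ := by
    have := hl.1
    intro h
    simp only [List.nodup_cons, List.nodup_append, List.mem_append, List.mem_cons] at this
    simp only [List.mem_append, List.mem_cons] at h
    exact this.2.2.2 c (by simp) c (by tauto) rfl
  obtain ⟨a', ha', c', hc', hac, ha'p, hc'p⟩ := exists_adj_between_arcs hall p (by simp) hc
    (fun h => hdisj _ h q.start_mem_support) (fun h => hdisj _ h q.end_mem_support)
  obtain ⟨m₁, m₂, h₁₂⟩ := List.append_of_mem hc'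
  obtain ⟨m₃, m₄, h₃₄⟩ := List.append_of_mem ha'
  rw [h₁₂, h₃₄] at hl hall hlen
  have hr' : b :: ((m₁ ++ c' :: m₂) ++ e :: (m₃ ++ a' :: m₄)) ~r
      c' :: ((m₂ ++ e :: m₃) ++ a' :: (m₄ ++ b :: m₁)) := by
    simpa using isRotated_cons_append_cons b c' m₁ (m₂ ++ e :: (m₃ ++ a' :: m₄))
  replace hl := hl.isRotated hr'
  replace hall : ∀ x, x ∈ c' :: ((m₂ ++ e :: m₃) ++ a' :: (m₄ ++ b :: m₁)) :=
    fun x => hr'.mem_iff.1 (hall x)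
  rw [hr'.perm.length_eq] at hlen
  have he : e ∉ m₄ ++ b :: m₁ := by
    have := hl.1
    intro h
    simp only [List.nodup_cons, List.nodup_append, List.mem_append, List.mem_cons] at this
    simp only [List.mem_append, List.mem_cons] at h
    exact this.2.2.2 e (by simp) e (by tauto) rfl
  obtain ⟨b', hb', e', he', hbe, -, -⟩ := exists_adj_between_arcs hall q (by simp) he
    (hdisj _ hc'p) (hdisj _ ha'p)
  obtain ⟨n₁, n₂, k₁₂⟩ := List.append_of_mem he'
  obtain ⟨n₃, n₄, k₃₄⟩ := List.append_of_mem hb'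
  rw [k₁₂, k₃₄] at hl hlen
  simp only [List.append_assoc, List.cons_append] at hl hlen
  exact hl.hasMinor_of_crossing hlen hac.symm hbe.symm

end Structure

section IsometricEmbedding

theorem Walk.exists_retract {A : Set V} {v : V}
    (sep : ∀ a ∈ A, a ≠ v → ∀ b ∉ A, ¬ G.Adj a b) {x y : V} (p : G.Walk x y) (hy : y ∈ A) :
    ∃ (x' : A) (q : (G.induce A).Walk x' ⟨y, hy⟩), (x ∈ A → x' = x) ∧ (x ∉ A → x' = v) ∧
      ∀ z ∈ q.support, (z : V) ∈ p.support := by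
  induction p with
  | nil => exact ⟨⟨_, hy⟩, Walk.nil, fun _ => rfl, fun h => absurd hy h, by simp⟩
  | @cons u u' _ h p ih =>
    obtain ⟨x', q, h₁, h₂, hq⟩ := ih hy
    have hq' : ∀ z ∈ q.support, (z : V) ∈ (Walk.cons h p).support := fun z hz =>
      List.mem_cons_of_mem _ (hq z hz)
    by_cases hu : u ∈ A
    · by_cases hu' : u' ∈ A
      · have hadj : (G.induce A).Adj ⟨u, hu⟩ x' := by
          rw [induce_adj, h₁ hu']
          exact h
        refine ⟨⟨u, hu⟩, Walk.cons hadj q, fun _ => rfl, fun hn => absurd hu hn, fun z hz => ?_⟩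
        rw [Walk.support_cons, List.mem_cons] at hz
        rcases hz with rfl | hz
        · exact Walk.start_mem_support _
        · exact hq' z hz
      · have huv : u = v := by
          by_contra hne
          exact sep u hu hne u' hu' h
        exact ⟨x', q, fun _ => (h₂ hu').trans huv.symm, fun hn => absurd hu hn, hq'⟩
    · refine ⟨x', q, fun hn => absurd hn hu, fun _ => ?_, hq'⟩
      by_cases hu' : u' ∈ A
      · rw [h₁ hu']
        by_contra hne
        exact sep u' hu' hne u hu h.symm
      · exact h₂ hu'

namespace IsGeodesicMetric

variable {d : V → V → ℝ}

theorem induce (hd : G.IsGeodesicMetric d) {A : Set V} {v : V}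
    (sep : ∀ a ∈ A, a ≠ v → ∀ b ∉ A, ¬ G.Adj a b) :
    (G.induce A).IsGeodesicMetric fun x y : A => d x y := by
  refine ⟨fun x => hd.self x, fun x y => hd.symm x y, fun x y z => hd.tri x y z, ?_⟩
  rintro ⟨x, hx⟩ ⟨y, hy⟩
  obtain ⟨p, hp⟩ := hd.walk x y
  obtain ⟨⟨x', hx'⟩, q, h, -, hq⟩ := p.exists_retract sep hy
  obtain rfl : x' = x := h hx
  exact ⟨q, fun z hz => hp z (hq z hz)⟩

theorem add_eq_of_separating (hd : G.IsGeodesicMetric d) {v : V} {S : Set V}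
    (sep : ∀ a ∈ S, ∀ b ∉ S, G.Adj a b → b = v) {x y : V} (hx : x ∈ S) (hy : y ∉ S) :
    d x v + d v y = d x y := by
  obtain ⟨p, hp⟩ := hd.walk x y
  obtain ⟨t, ht, h₁, h₂⟩ := p.exists_boundary_dart S hx hy
  have := p.dart_snd_mem_support_of_mem_darts ht
  rw [sep _ h₁ _ h₂ t.adj] at this
  exact hp v this

theorem isL1_of_separating (hd : G.IsGeodesicMetric d) {v : V} {S : Set V} (hv : v ∉ S)
    (sep : ∀ a ∈ S, ∀ b ∉ S, G.Adj a b → b = v)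
    (h₁ : IsL1 fun x y : (insert v S : Set V) => d x y)
    (h₂ : IsL1 fun x y : (Sᶜ : Set V) => d x y) :
    IsL1 d := by
  classical
  have := (h₁.comap fun x : V => if h : x ∈ S then ⟨x, Or.inr h⟩ else ⟨v, Or.inl rfl⟩).add
    (h₂.comap fun x : V => if h : x ∈ S then ⟨v, hv⟩ else ⟨x, h⟩)
  convert this using 3 with x y
  by_cases hx : x ∈ S <;> by_cases hy : y ∈ S <;>
    simp only [hx, hy, dif_pos, dif_neg, not_false_iff]
  · simp [hd.self]
  · exact (hd.add_eq_of_separating sep hx hy).symm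
  · rw [hd.symm x y, hd.symm v y, hd.symm x v]
    exact (hd.add_eq_of_separating sep hy hx).symm
  · simp [hd.self]

theorem isL1_of_noCutVertex [Fintype V] (hd : G.IsGeodesicMetric d) (h2 : G.NoCutVertex)
    (hminor : ¬ G.HasMinor (completeBipartiteGraph (Fin 2) (Fin 3))) : IsL1 d := by
  rcases le_or_gt (Fintype.card V) 4 with hcard | hcard
  · exact isL1_of_card_le_four d hd.self hd.symm hd.tri Finset.univ.toList (by simp)
      (by simpa using hcard)
  obtain ⟨x, y, hxy⟩ := Fintype.exists_pair_of_one_lt_card (α := V) (by omega)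
  obtain ⟨a, b, hab⟩ : ∃ a b, G.Adj a b := by
    obtain ⟨p, -⟩ := hd.walk x y
    cases p with
    | nil => exact absurd rfl hxy
    | cons h p => exact ⟨_, _, h⟩
  obtain ⟨l, hl, hall⟩ := exists_hamiltonian_cycleList h2 hminor hab
  have hlen : 5 ≤ l.length := by
    classical
    have h := Finset.card_le_card (s := Finset.univ) (t := l.toFinset) fun z _ => by simp [hall z]
    have := l.toFinset_card_le
    rw [Finset.card_univ] at h
    omega
  refine isL1_of_kalmanson d hd.self hd.symm hd.tri l hall fun a b c e hs => ?_
  obtain ⟨p, hp⟩ := hd.walk a c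
  obtain ⟨q, hq⟩ := hd.walk b e
  obtain ⟨z, hzp, hzq⟩ := hl.exists_mem_support_inter hminor hall hlen hs p q
  have hac := hp z hzp
  have hbe := hq z hzq
  constructor
  · linarith [hd.tri a z b, hd.tri c z e, hd.symm z b, hd.symm z c]
  · linarith [hd.tri a z e, hd.tri b z c]

theorem isL1 [Finite V] (hd : G.IsGeodesicMetric d)
    (hminor : ¬ G.HasMinor (completeBipartiteGraph (Fin 2) (Fin 3))) : IsL1 d := by
  induction hn : Nat.card V using Nat.strong_induction_on generalizing V with
  | _ n ih =>
    by_cases h2 : G.NoCutVertex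
    · have := Fintype.ofFinite V
      exact hd.isL1_of_noCutVertex h2 hminor
    unfold NoCutVertex at h2
    push Not at h2
    obtain ⟨v, S, hv, ⟨s, hs⟩, sep, y, hy, hyv⟩ := h2
    have smaller : ∀ A : Set V, ∀ z ∉ A, Nat.card A < n := by
      intro A z hz
      rw [← hn, ← Set.ncard_univ V, Nat.card_coe_set_eq]
      exact Set.ncard_lt_ncard (Set.ssubset_univ_iff.2 fun h => hz (h ▸ Set.mem_univ z))
    refine hd.isL1_of_separating hv sep ?_ ?_
    · refine ih _ (smaller _ y ?_) (hd.induce (v := v) ?_)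
        (fun h => hminor (hasMinor_of_induce _ h)) rfl
      · rintro (h | h)
        · exact hyv h
        · exact hy h
      · rintro a (rfl | ha) hav b hb hab
        · exact hav rfl
        · exact hb (Or.inl (sep a ha b (fun h => hb (Or.inr h)) hab))
    · refine ih _ (smaller _ s (not_not.2 hs)) (hd.induce (v := v) ?_)
        (fun h => hminor (hasMinor_of_induce _ h)) rfl
      intro a ha hav b hb hab
      exact hav (sep b (not_not.1 hb) a ha hab.symm)

end IsGeodesicMetric

end IsometricEmbedding

end SimpleGraph

/-- Gupta–Newman–Rabinovich: for a finite connected simple graph `G`,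
every positive edge-weighting induces an `ℓ₁`-embeddable shortest-path metric on the
vertices if and only if `G` has no `K_{2,3}` minor. -/
theorem l1_embeddable_for_all_weights_iff_no_K23_minor
    (V : Type*) [Fintype V] (G : SimpleGraph V) (hconn : G.Connected) :
    (∀ w : Sym2 V → ℝ, (∀ e ∈ G.edgeSet, 0 < w e) →
      ∃ (m : ℕ) (g : V → Fin m → ℝ),
        ∀ x y : V, G.weightedDist w x y = ∑ i, |g x i - g y i|) ↔
    ¬ G.HasMinor (completeBipartiteGraph (Fin 2) (Fin 3)) := by
  constructor
  · intro h hminor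
    obtain ⟨w, hw, hL1⟩ := SimpleGraph.exists_weight_not_isL1 hconn hminor
    obtain ⟨m, g, hg⟩ := h w hw
    exact hL1 ⟨Fin m, inferInstance, g, hg⟩
  · intro hminor w hw
    exact ((SimpleGraph.isGeodesicMetric_weightedDist hconn hw).isL1 hminor).exists_fin
end

section
/- Let ℓ₁, ℓ₂, ℓ₃ ≥ 1 and let Θ = Θ(ℓ₁,ℓ₂,ℓ₃) be the theta space with segment lengths ℓ₁, ℓ₂, ℓ₃ and metric d. Then there exist two three-element sets B and R of points of Θ such that ∑_{{x,y}⊆R} d(x,y) + ∑_{{x,y}⊆B} d(x,y) − ∑_{x∈R, y∈B} d(x,y) ≥ 1/12, where the first two sums range over unordered pairs of distinct points of R (respectively B) and the last sum ranges over all nine pairs (x,y) ∈ R × B. -/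
/-- Given two distinct indices in `Fin 3`, the remaining index. -/
def thetaOther (i j : Fin 3) : Fin 3 := if j = i + 1 then i + 2 else i + 1

/-- The shortest-path distance on the theta space `Θ(ℓ 0, ℓ 1, ℓ 2)`, expressed on raw
coordinates: a point `(i, s)` is the point at distance `s` from `u` along the `i`-th
segment (of length `ℓ i`), where all points `(i, 0)` are identified to a single
point `u` and all points `(i, ℓ i)` are identified to a single point `v`. -/
noncomputable def thetaDist (ℓ : Fin 3 → ℝ) (p q : Fin 3 × ℝ) : ℝ :=
  if p.1 = q.1 then
    min |p.2 - q.2|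
      (min (p.2 + q.2 + min (ℓ (p.1 + 1)) (ℓ (p.1 + 2)))
        ((ℓ p.1 - p.2) + (ℓ p.1 - q.2) + min (ℓ (p.1 + 1)) (ℓ (p.1 + 2))))
  else
    min (p.2 + q.2)
      (min ((ℓ p.1 - p.2) + (ℓ q.1 - q.2))
        (min (p.2 + ℓ (thetaOther p.1 q.1) + (ℓ q.1 - q.2))
          ((ℓ p.1 - p.2) + ℓ (thetaOther p.1 q.1) + q.2)))

/-- `(i, s)` is a valid coordinate for a point of the theta space `Θ(ℓ 0, ℓ 1, ℓ 2)`. -/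
def IsThetaPoint (ℓ : Fin 3 → ℝ) (p : Fin 3 × ℝ) : Prop :=
  0 ≤ p.2 ∧ p.2 ≤ ℓ p.1

/-- Canonical representatives of the points of the theta space `Θ(ℓ 0, ℓ 1, ℓ 2)`:
every point of the theta space has exactly one canonical coordinate representative,
the two branch vertices `u, v` being represented on segment `0`. -/
def IsThetaRep (ℓ : Fin 3 → ℝ) (p : Fin 3 × ℝ) : Prop :=
  IsThetaPoint ℓ p ∧ (p.2 = 0 → p.1 = 0) ∧ (p.2 = ℓ p.1 → p.1 = 0)

theorem thetaOther_eq {i j k : Fin 3} (hij : i ≠ j) (hik : i ≠ k) (hjk : j ≠ k) :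
    thetaOther i j = k := by
  revert i j k
  decide

theorem thetaDist_of_ne (ℓ : Fin 3 → ℝ) {i j k : Fin 3} (hij : i ≠ j) (hik : i ≠ k)
    (hjk : j ≠ k) (s t : ℝ) :
    thetaDist ℓ (i, s) (j, t) = min (s + t) (min ((ℓ i - s) + (ℓ j - t))
      (min (s + ℓ k + (ℓ j - t)) ((ℓ i - s) + ℓ k + t))) := by
  simp [thetaDist, hij, thetaOther_eq hij hik hjk]

theorem thetaDist_same_le (ℓ : Fin 3 → ℝ) (i : Fin 3) (s t : ℝ) :
    thetaDist ℓ (i, s) (i, t) ≤ |s - t| := by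
  simp [thetaDist]

theorem thetaDist_self_nonneg {ℓ : Fin 3 → ℝ} (hℓ : ∀ i, 0 ≤ ℓ i) {p : Fin 3 × ℝ}
    (hp : IsThetaPoint ℓ p) : 0 ≤ thetaDist ℓ p p := by
  have hm : 0 ≤ min (ℓ (p.1 + 1)) (ℓ (p.1 + 2)) := le_min (hℓ _) (hℓ _)
  obtain ⟨h₀, h₁⟩ := hp
  rw [thetaDist, if_pos rfl]
  refine le_min (abs_nonneg _) (le_min ?_ ?_) <;> linarith

theorem thetaDist_le_via_zero (ℓ : Fin 3 → ℝ) {i j : Fin 3} (hij : i ≠ j) (s t : ℝ) :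
    thetaDist ℓ (i, s) (j, t) ≤ s + t := by
  simp [thetaDist, hij]

theorem thetaDist_le_via_end (ℓ : Fin 3 → ℝ) {i j : Fin 3} (hij : i ≠ j) (s t : ℝ) :
    thetaDist ℓ (i, s) (j, t) ≤ (ℓ i - s) + (ℓ j - t) := by
  simp [thetaDist, hij]

theorem thetaDist_comm_of_ne (ℓ : Fin 3 → ℝ) {i j k : Fin 3} (hij : i ≠ j) (hik : i ≠ k)
    (hjk : j ≠ k) (s t : ℝ) :
    thetaDist ℓ (i, s) (j, t) = thetaDist ℓ (j, t) (i, s) := by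
  rw [thetaDist_of_ne ℓ hij hik hjk, thetaDist_of_ne ℓ hij.symm hjk hik, add_comm t s,
    add_comm (ℓ j - t), min_comm (t + ℓ k + (ℓ i - s))]
  congr 3 <;> ring

theorem isThetaRep_of_mem_Ioo {ℓ : Fin 3 → ℝ} {i : Fin 3} {s : ℝ} (h₀ : 0 < s)
    (h₁ : s < ℓ i) : IsThetaRep ℓ (i, s) :=
  ⟨⟨h₀.le, h₁.le⟩, fun h => absurd h h₀.ne', fun h => absurd h h₁.ne⟩

theorem sum_sum_thetaDist_ge {ℓ : Fin 3 → ℝ} (hℓ : ∀ i, 0 ≤ ℓ i) {i j k : Fin 3}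
    (hij : i ≠ j) (hik : i ≠ k) (hjk : j ≠ k) {r s t : ℝ} (hr : IsThetaPoint ℓ (i, r))
    (hs : IsThetaPoint ℓ (j, s)) (ht : IsThetaPoint ℓ (k, t)) :
    thetaDist ℓ (i, r) (j, s) + thetaDist ℓ (i, r) (k, t) + thetaDist ℓ (j, s) (k, t) ≤
      (∑ x ∈ ({(i, r), (j, s), (k, t)} : Finset (Fin 3 × ℝ)),
        ∑ y ∈ ({(i, r), (j, s), (k, t)} : Finset (Fin 3 × ℝ)), thetaDist ℓ x y) / 2 := by
  have hi := thetaDist_self_nonneg hℓ hr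
  have hj := thetaDist_self_nonneg hℓ hs
  have hk := thetaDist_self_nonneg hℓ ht
  have h₁ := thetaDist_comm_of_ne ℓ hij hik hjk r s
  have h₂ := thetaDist_comm_of_ne ℓ hik hij hjk.symm r t
  have h₃ := thetaDist_comm_of_ne ℓ hjk hij.symm hik.symm s t
  simp only [Finset.sum_insert, Finset.sum_singleton, Finset.mem_insert, Finset.mem_singleton,
    Prod.mk.injEq, hij, hik, hjk, false_and, or_self, not_false_eq_true]
  linarith

/-- If segment `i` is shortest, the witnesses are the midpoints of the three segments (`R`) and
three points of the open segments (`B`) of which those on segments `i`, `j` are antipodal in the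
cycle these two segments form. -/
theorem exists_witness_sets_of_shortest {ℓ : Fin 3 → ℝ} (hℓ : ∀ i, 0 < ℓ i) {i j k : Fin 3}
    (hij : i ≠ j) (hik : i ≠ k) (hjk : j ≠ k) (hj : ℓ i ≤ ℓ j) (hk : ℓ i ≤ ℓ k) :
    ∃ B R : Finset (Fin 3 × ℝ),
      B.card = 3 ∧ R.card = 3 ∧
      (∀ p ∈ B, IsThetaRep ℓ p) ∧ (∀ p ∈ R, IsThetaRep ℓ p) ∧
      ℓ i / 4 ≤ (∑ x ∈ R, ∑ y ∈ R, thetaDist ℓ x y) / 2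
          + (∑ x ∈ B, ∑ y ∈ B, thetaDist ℓ x y) / 2
          - ∑ x ∈ R, ∑ y ∈ B, thetaDist ℓ x y := by
  have hi₀ := hℓ i
  have hx : IsThetaRep ℓ (i, ℓ i / 2) := isThetaRep_of_mem_Ioo (by linarith) (by linarith)
  have hx' : IsThetaRep ℓ (j, ℓ j / 2) := isThetaRep_of_mem_Ioo (by linarith) (by linarith)
  have hq : IsThetaRep ℓ (k, ℓ k / 2) := isThetaRep_of_mem_Ioo (by linarith) (by linarith)
  have hy : IsThetaRep ℓ (i, 7 * ℓ i / 8) := isThetaRep_of_mem_Ioo (by linarith) (by linarith)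
  have hy' : IsThetaRep ℓ (j, ℓ j / 2 - 3 * ℓ i / 8) :=
    isThetaRep_of_mem_Ioo (by linarith) (by linarith)
  have hp : IsThetaRep ℓ (k, ℓ k / 2 + ℓ i / 4) :=
    isThetaRep_of_mem_Ioo (by linarith) (by linarith)
  refine ⟨{(i, 7 * ℓ i / 8), (j, ℓ j / 2 - 3 * ℓ i / 8), (k, ℓ k / 2 + ℓ i / 4)},
    {(i, ℓ i / 2), (j, ℓ j / 2), (k, ℓ k / 2)}, ?_, ?_, ?_, ?_, ?_⟩
  · rw [Finset.card_eq_three]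
    exact ⟨_, _, _, by simp [hij], by simp [hik], by simp [hjk], rfl⟩
  · rw [Finset.card_eq_three]
    exact ⟨_, _, _, by simp [hij], by simp [hik], by simp [hjk], rfl⟩
  · simp only [Finset.mem_insert, Finset.mem_singleton, forall_eq_or_imp, forall_eq]
    exact ⟨hy, hy', hp⟩
  · simp only [Finset.mem_insert, Finset.mem_singleton, forall_eq_or_imp, forall_eq]
    exact ⟨hx, hx', hq⟩
  have hR := sum_sum_thetaDist_ge (fun m => (hℓ m).le) hij hik hjk hx.1 hx'.1 hq.1
  have hB := sum_sum_thetaDist_ge (fun m => (hℓ m).le) hij hik hjk hy.1 hy'.1 hp.1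
  have hxx' : (ℓ i + ℓ j) / 2 ≤ thetaDist ℓ (i, ℓ i / 2) (j, ℓ j / 2) := by
    rw [thetaDist_of_ne ℓ hij hik hjk]
    refine le_min ?_ (le_min ?_ (le_min ?_ ?_)) <;> linarith
  have hxq : (ℓ i + ℓ k) / 2 ≤ thetaDist ℓ (i, ℓ i / 2) (k, ℓ k / 2) := by
    rw [thetaDist_of_ne ℓ hik hij hjk.symm]
    refine le_min ?_ (le_min ?_ (le_min ?_ ?_)) <;> linarith
  have hx'q : (ℓ j + ℓ k) / 2 ≤ thetaDist ℓ (j, ℓ j / 2) (k, ℓ k / 2) := by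
    rw [thetaDist_of_ne ℓ hjk hij.symm hik.symm]
    refine le_min ?_ (le_min ?_ (le_min ?_ ?_)) <;> linarith
  have hyy' : (ℓ i + ℓ j) / 2 ≤ thetaDist ℓ (i, 7 * ℓ i / 8) (j, ℓ j / 2 - 3 * ℓ i / 8) := by
    rw [thetaDist_of_ne ℓ hij hik hjk]
    refine le_min ?_ (le_min ?_ (le_min ?_ ?_)) <;> linarith
  have hyp : ℓ k / 2 - ℓ i / 8 ≤ thetaDist ℓ (i, 7 * ℓ i / 8) (k, ℓ k / 2 + ℓ i / 4) := by
    rw [thetaDist_of_ne ℓ hik hij hjk.symm]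
    refine le_min ?_ (le_min ?_ (le_min ?_ ?_)) <;> linarith
  have hy'p : (ℓ j + ℓ k) / 2 - ℓ i / 8 ≤
      thetaDist ℓ (j, ℓ j / 2 - 3 * ℓ i / 8) (k, ℓ k / 2 + ℓ i / 4) := by
    rw [thetaDist_of_ne ℓ hjk hij.symm hik.symm]
    refine le_min ?_ (le_min ?_ (le_min ?_ ?_)) <;> linarith
  have hxy : thetaDist ℓ (i, ℓ i / 2) (i, 7 * ℓ i / 8) ≤ 3 * ℓ i / 8 :=
    (thetaDist_same_le ..).trans (abs_le.2 ⟨by linarith, by linarith⟩)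
  have hx'y' : thetaDist ℓ (j, ℓ j / 2) (j, ℓ j / 2 - 3 * ℓ i / 8) ≤ 3 * ℓ i / 8 :=
    (thetaDist_same_le ..).trans (abs_le.2 ⟨by linarith, by linarith⟩)
  have hqp : thetaDist ℓ (k, ℓ k / 2) (k, ℓ k / 2 + ℓ i / 4) ≤ ℓ i / 4 :=
    (thetaDist_same_le ..).trans (abs_le.2 ⟨by linarith, by linarith⟩)
  have hxy' := thetaDist_le_via_zero ℓ hij (ℓ i / 2) (ℓ j / 2 - 3 * ℓ i / 8)
  have hxp := thetaDist_le_via_end ℓ hik (ℓ i / 2) (ℓ k / 2 + ℓ i / 4)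
  have hx'y := thetaDist_le_via_end ℓ hij.symm (ℓ j / 2) (7 * ℓ i / 8)
  have hx'p := thetaDist_le_via_end ℓ hjk (ℓ j / 2) (ℓ k / 2 + ℓ i / 4)
  have hqy := thetaDist_le_via_end ℓ hik.symm (ℓ k / 2) (7 * ℓ i / 8)
  have hqy' := thetaDist_le_via_zero ℓ hjk.symm (ℓ k / 2) (ℓ j / 2 - 3 * ℓ i / 8)
  have hRB : ∑ x ∈ ({(i, ℓ i / 2), (j, ℓ j / 2), (k, ℓ k / 2)} : Finset (Fin 3 × ℝ)),
      ∑ y ∈ ({(i, 7 * ℓ i / 8), (j, ℓ j / 2 - 3 * ℓ i / 8), (k, ℓ k / 2 + ℓ i / 4)} :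
        Finset (Fin 3 × ℝ)), thetaDist ℓ x y ≤ ℓ i + 2 * ℓ j + 2 * ℓ k := by
    simp only [Finset.sum_insert, Finset.sum_singleton, Finset.mem_insert, Finset.mem_singleton,
      Prod.mk.injEq, hij, hik, hjk, false_and, or_self, not_false_eq_true]
    linarith
  linarith

/-- in a theta space all of whose three segment lengths are at least `1`,
there are two three-element sets `B` and `R` of points such that the sum of distances
within `R`, plus the sum of distances within `B`, minus the sum of the nine
distances between `R` and `B`, is at least `1/12`. -/
theorem theta_negative_type_witness_sets (ℓ : Fin 3 → ℝ) (hℓ : ∀ i, 1 ≤ ℓ i) :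
    ∃ B R : Finset (Fin 3 × ℝ),
      B.card = 3 ∧ R.card = 3 ∧
      (∀ p ∈ B, IsThetaRep ℓ p) ∧ (∀ p ∈ R, IsThetaRep ℓ p) ∧
      1 / 12 ≤ (∑ x ∈ R, ∑ y ∈ R, thetaDist ℓ x y) / 2
          + (∑ x ∈ B, ∑ y ∈ B, thetaDist ℓ x y) / 2
          - ∑ x ∈ R, ∑ y ∈ B, thetaDist ℓ x y := by
  obtain ⟨i, hi⟩ := Finite.exists_min ℓ
  obtain ⟨B, R, hB, hR, hB', hR', h⟩ :=
    exists_witness_sets_of_shortest (fun m => one_pos.trans_le (hℓ m))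
      (show i ≠ i + 1 by clear hi; decide +revert)
      (show i ≠ i + 2 by clear hi; decide +revert)
      (show i + 1 ≠ i + 2 by clear hi; decide +revert) (hi _) (hi _)
  exact ⟨B, R, hB, hR, hB', hR', by linarith [hℓ i]⟩
end

section
/- Let ℓ₁, ℓ₂, ℓ₃ ≥ 1 and let Θ = Θ(ℓ₁,ℓ₂,ℓ₃) be the theta space with segment lengths ℓ₁, ℓ₂, ℓ₃ and metric d. Then the negative type gap of Θ satisfies Γ(Θ,d) ≥ 1/432. -/
/-- The negative type gap of the theta space `Θ(ℓ 0, ℓ 1, ℓ 2)`: the supremum of the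
energies `∑ ω(x) ω(y) d(x,y)` over all finitely supported functions `ω` on its points
(given by their canonical representatives) with `∑ ω(x) = 0` and `∑ |ω(x)| = 1`. -/
noncomputable def thetaGap (ℓ : Fin 3 → ℝ) : ℝ :=
  sSup {γ : ℝ | ∃ ω : (Fin 3 × ℝ) →₀ ℝ,
    (∀ p ∈ ω.support, IsThetaRep ℓ p) ∧
    (∑ x ∈ ω.support, ω x) = 0 ∧
    (∑ x ∈ ω.support, |ω x|) = 1 ∧
    γ = ∑ x ∈ ω.support, ∑ y ∈ ω.support, ω x * ω y * thetaDist ℓ x y}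

lemma thetaDist_nonneg {ℓ : Fin 3 → ℝ} (hℓ : ∀ i, 0 ≤ ℓ i) {p q : Fin 3 × ℝ}
    (hp : IsThetaPoint ℓ p) (hq : IsThetaPoint ℓ q) : 0 ≤ thetaDist ℓ p q := by
  obtain ⟨hp0, hp1⟩ := hp
  obtain ⟨hq0, hq1⟩ := hq
  have h1 := hℓ (p.1 + 1)
  have h2 := hℓ (p.1 + 2)
  have h3 := hℓ (thetaOther p.1 q.1)
  unfold thetaDist
  split_ifs with h
  · rw [← h] at hq1
    have hm : 0 ≤ min (ℓ (p.1 + 1)) (ℓ (p.1 + 2)) := le_min h1 h2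
    refine le_min (abs_nonneg _) (le_min ?_ ?_) <;> linarith
  · refine le_min ?_ (le_min ?_ (le_min ?_ ?_)) <;> linarith

lemma thetaDist_le_add {ℓ : Fin 3 → ℝ} {p q : Fin 3 × ℝ} (hp : 0 ≤ p.2) (hq : 0 ≤ q.2) :
    thetaDist ℓ p q ≤ p.2 + q.2 := by
  unfold thetaDist
  split_ifs with h
  · exact (min_le_left _ _).trans (abs_le.2 ⟨by linarith, by linarith⟩)
  · exact min_le_left _ _

/-- Within a quarter of the midpoints, a shortest path between two segments passes through
the nearer of the two branch vertices. -/
lemma thetaDist_near_midpoints {ℓ : Fin 3 → ℝ} (hℓ : ∀ i, 1 ≤ ℓ i) (i j : Fin 3) {s t : ℝ}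
    (hs : |s| ≤ 1 / 4) (ht : |t| ≤ 1 / 4) :
    thetaDist ℓ (i, ℓ i / 2 + s) (j, ℓ j / 2 + t) =
      if i = j then |s - t| else (ℓ i + ℓ j) / 2 - |s + t| := by
  obtain ⟨hs0, hs1⟩ := abs_le.1 hs
  obtain ⟨ht0, ht1⟩ := abs_le.1 ht
  have hi := hℓ i
  unfold thetaDist
  split_ifs with h
  · subst h
    have hm : 1 ≤ min (ℓ (i + 1)) (ℓ (i + 2)) := le_min (hℓ _) (hℓ _)
    have hst : |s - t| ≤ 1 / 2 := abs_le.2 ⟨by linarith, by linarith⟩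
    simp only [add_sub_add_left_eq_sub]
    exact min_eq_left (le_min (by linarith) (by linarith))
  · have hk := hℓ (thetaOther i j)
    simp only
    rcases le_total 0 (s + t) with h0 | h0
    · rw [abs_of_nonneg h0, min_eq_right, min_eq_left]
      · ring
      · refine le_min ?_ ?_ <;> linarith
      · exact (min_le_left _ _).trans (by linarith)
    · rw [abs_of_nonpos h0, min_eq_left]
      · ring
      · refine le_min ?_ (le_min ?_ ?_) <;> linarith

lemma thetaGap_bddAbove {ℓ : Fin 3 → ℝ} (hℓ : ∀ i, 0 ≤ ℓ i) :
    BddAbove {γ : ℝ | ∃ ω : (Fin 3 × ℝ) →₀ ℝ,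
      (∀ p ∈ ω.support, IsThetaRep ℓ p) ∧
      (∑ x ∈ ω.support, ω x) = 0 ∧
      (∑ x ∈ ω.support, |ω x|) = 1 ∧
      γ = ∑ x ∈ ω.support, ∑ y ∈ ω.support, ω x * ω y * thetaDist ℓ x y} := by
  set D := ∑ i, ℓ i
  have hD : ∀ i, ℓ i ≤ D := fun i =>
    Finset.single_le_sum (fun k _ => hℓ k) (Finset.mem_univ i)
  refine ⟨2 * D, ?_⟩
  rintro γ ⟨ω, hrep, -, h1, rfl⟩
  calc ∑ x ∈ ω.support, ∑ y ∈ ω.support, ω x * ω y * thetaDist ℓ x y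
      ≤ ∑ x ∈ ω.support, ∑ y ∈ ω.support, |ω x| * |ω y| * (2 * D) := by
        refine Finset.sum_le_sum fun x hx => Finset.sum_le_sum fun y hy => ?_
        have hx := (hrep x hx).1
        have hy := (hrep y hy).1
        refine mul_le_mul (abs_mul (ω x) (ω y) ▸ le_abs_self _) ?_
          (thetaDist_nonneg hℓ hx hy) (by positivity)
        have := thetaDist_le_add (ℓ := ℓ) hx.1 hy.1
        linarith [hx.2, hy.2, hD x.1, hD y.1]
    _ = 2 * D := by
        simp_rw [← Finset.sum_mul, ← Finset.mul_sum, ← Finset.sum_mul, h1, one_mul]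

/-- The energy of a weighted family of distinct points is a lower bound for the gap. -/
lemma le_thetaGap_of_family {ℓ : Fin 3 → ℝ} (hℓ : ∀ i, 0 ≤ ℓ i) {ι : Type*} [Fintype ι]
    (x : ι ↪ Fin 3 × ℝ) (w : ι → ℝ) (hx : ∀ k, IsThetaRep ℓ (x k)) (hw : ∀ k, w k ≠ 0)
    (hw0 : ∑ k, w k = 0) (hw1 : ∑ k, |w k| = 1) :
    ∑ k, ∑ l, w k * w l * thetaDist ℓ (x k) (x l) ≤ thetaGap ℓ := by
  have hsupp : (Finsupp.embDomain x (Finsupp.equivFunOnFinite.symm w)).support =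
      Finset.univ.map x := by
    rw [Finsupp.support_embDomain]
    congr 1
    ext k
    simp [hw k]
  refine le_csSup (thetaGap_bddAbove hℓ)
    ⟨Finsupp.embDomain x (Finsupp.equivFunOnFinite.symm w), ?_, ?_, ?_, ?_⟩ <;> rw [hsupp]
  · simpa using fun k => hx k
  all_goals simp [Finsupp.embDomain_apply_self, hw0, hw1]

/-- a theta space all of whose three segment lengths are at least `1`
has negative type gap at least `1/432`. -/
theorem theta_gap_ge (ℓ : Fin 3 → ℝ) (hℓ : ∀ i, 1 ≤ ℓ i) :
    1 / 432 ≤ thetaGap ℓ := by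
  let seg : Fin 7 → Fin 3 := ![0, 0, 1, 1, 2, 2, 2]
  let off : Fin 7 → ℝ := ![0, -1 / 4, 0, 1 / 4, 0, -1 / 4, 1 / 4]
  let w : Fin 7 → ℝ := ![1 / 6, -1 / 6, 1 / 6, -1 / 6, 1 / 6, -1 / 12, -1 / 12]
  have hoff : ∀ k, |off k| ≤ 1 / 4 := by
    intro k
    fin_cases k <;> norm_num [off, abs_le]
  have hinj : Function.Injective fun k => (seg k, ℓ (seg k) / 2 + off k) := by
    intro k l h
    obtain ⟨h1, h2⟩ := Prod.mk.inj h
    rw [h1, add_right_inj] at h2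
    clear h
    revert h1 h2
    fin_cases k <;> fin_cases l <;> norm_num [seg, off] <;> decide
  have hrep : ∀ k, IsThetaRep ℓ (seg k, ℓ (seg k) / 2 + off k) := by
    intro k
    obtain ⟨h1, h2⟩ := abs_le.1 (hoff k)
    have h3 := hℓ (seg k)
    refine ⟨⟨?_, ?_⟩, fun h => ?_, fun h => ?_⟩ <;> dsimp only at * <;> linarith
  have key := le_thetaGap_of_family (fun i => zero_le_one.trans (hℓ i)) ⟨_, hinj⟩ w hrep
    (by intro k; fin_cases k <;> norm_num [w])
    (by norm_num [w, Fin.sum_univ_succ])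
    (by norm_num [w, Fin.sum_univ_succ, abs_div])
  refine le_trans ?_ key
  simp only [Function.Embedding.coeFn_mk, thetaDist_near_midpoints hℓ _ _ (hoff _) (hoff _)]
  simp only [Fin.sum_univ_seven, w, seg, off, Matrix.cons_val]
  have h02 : (0 : Fin 3) ≠ 2 := by decide
  have h12 : (1 : Fin 3) ≠ 2 := by decide
  norm_num [abs_div, h02, h12, h02.symm, h12.symm]
  linarith
end

section
/- Let G be a finite connected simple graph that contains K_{2,3} as a minor, and let G' be the 180-subdivision of G, with shortest-path metric dist on its vertex set. Then the finite metric space (V(G'), dist) does not have negative type: there exists ω : V(G') → ℝ with ∑_x ω(x) = 0 and ∑_{x,y} ω(x)ω(y) dist(x,y) > 0. -/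
/-- The vertex type of the `k`-subdivision of `G`: the vertices of `G` together with
`k` internal vertices `(e, 0), …, (e, k-1)` for every edge `e` of `G` (recorded as an
ordered pair of its endpoints in increasing order). -/
abbrev SubdivVert (V : Type*) [LinearOrder V] (k : ℕ) (G : SimpleGraph V) : Type _ :=
  V ⊕ ({e : V × V // e.1 < e.2 ∧ G.Adj e.1 e.2} × Fin k)

/-- The `k`-subdivision of `G`: every edge `ab` of `G` (with `a < b`) is replaced by the
path `a, (ab, 0), (ab, 1), …, (ab, k-1), b` of length `k + 1`. -/
def SimpleGraph.subdivision {V : Type*} [LinearOrder V] (k : ℕ) (G : SimpleGraph V) :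
    SimpleGraph (SubdivVert V k G) :=
  SimpleGraph.fromRel fun x y =>
    match x, y with
    | Sum.inl a, Sum.inl b => G.Adj a b ∧ k = 0
    | Sum.inl a, Sum.inr (e, i) =>
        (a = e.1.1 ∧ (i : ℕ) = 0) ∨ (a = e.1.2 ∧ (i : ℕ) = k - 1)
    | Sum.inr (e, i), Sum.inr (e', i') => e = e' ∧ (i : ℕ) + 1 = (i' : ℕ)
    | Sum.inr _, Sum.inl _ => False

namespace SimpleGraph

section Subdivision

variable {V : Type*} [LinearOrder V] {G : SimpleGraph V} {k : ℕ}

/-- The point at distance `s` from `a` on the path of length `k + 1` which replaces the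
edge `ab` in the `k`-subdivision. -/
def subdivPoint (k : ℕ) {a b : V} (h : G.Adj a b) (s : ℕ) : SubdivVert V k G :=
  if hs : s = 0 then Sum.inl a
  else if hs' : k < s then Sum.inl b
  else if hab : a < b then Sum.inr (⟨(a, b), hab, h⟩, ⟨s - 1, by omega⟩)
  else Sum.inr (⟨(b, a), lt_of_le_of_ne (not_lt.1 hab) h.ne', h.symm⟩, ⟨k - s, by omega⟩)

lemma subdivPoint_zero {a b : V} (h : G.Adj a b) : subdivPoint k h 0 = Sum.inl a := by
  simp [subdivPoint]

lemma subdivPoint_last {a b : V} (h : G.Adj a b) : subdivPoint k h (k + 1) = Sum.inl b := by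
  simp [subdivPoint]

lemma subdivPoint_symm {a b : V} (h : G.Adj a b) {s : ℕ} (hs : s ≤ k + 1) :
    subdivPoint k h.symm (k + 1 - s) = subdivPoint k h s := by
  rcases Nat.eq_zero_or_pos s with rfl | h0
  · rw [subdivPoint_zero]; exact subdivPoint_last h.symm
  rcases hs.eq_or_lt with rfl | h1
  · rw [subdivPoint_last, Nat.sub_self, subdivPoint_zero]
  unfold subdivPoint
  have e₁ : ¬ k + 1 - s = 0 := by omega
  have e₂ : ¬ k < k + 1 - s := by omega
  have e₃ : ¬ s = 0 := by omega
  have e₄ : ¬ k < s := by omega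
  simp only [dif_neg e₁, dif_neg e₂, dif_neg e₃, dif_neg e₄]
  rcases lt_or_gt_of_ne h.ne with hab | hab
  · rw [dif_neg (not_lt.2 hab.le), dif_pos hab]
    exact congrArg Sum.inr (Prod.ext rfl (Fin.ext (by change _ - _ = _ - _; omega)))
  · rw [dif_pos hab, dif_neg (not_lt.2 hab.le)]
    exact congrArg Sum.inr (Prod.ext rfl (Fin.ext (by change _ - _ = _ - _; omega)))

lemma subdivision_adj_subdivPoint {a b : V} (h : G.Adj a b) {s : ℕ} (hs : s ≤ k) :
    (G.subdivision k).Adj (subdivPoint k h s) (subdivPoint k h (s + 1)) := by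
  have key : ∀ {a b : V} (h : G.Adj a b) (s : ℕ), a < b → s ≤ k →
      (G.subdivision k).Adj (subdivPoint k h s) (subdivPoint k h (s + 1)) := by
    intro a b h s hab hs
    unfold subdivision subdivPoint
    rw [fromRel_adj]
    by_cases h0 : s = 0
    · subst h0
      by_cases hk : k < 0 + 1
      · have hk0 : k = 0 := by omega
        simp [hk0, h, h.ne]
      · simp [hab, hk]
    · by_cases h1 : k < s + 1
      · have : s = k := by omega
        subst this
        simp [h0, hab]
      · have h2 : ¬ k < s := by omega
        simp [h0, h1, h2, hab]
        omega
  rcases lt_or_gt_of_ne h.ne with hab | hab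
  · exact key h s hab hs
  · rw [← subdivPoint_symm h (s := s) (by omega), ← subdivPoint_symm h (s := s + 1) (by omega)]
    have := key h.symm (k - s) hab (by omega)
    rw [show k + 1 - s = k - s + 1 by omega, show k + 1 - (s + 1) = k - s by omega]
    exact this.symm

lemma exists_walk_subdivPoint {a b : V} (h : G.Adj a b) {s t : ℕ} (hst : s ≤ t)
    (ht : t ≤ k + 1) :
    ∃ p : (G.subdivision k).Walk (subdivPoint k h s) (subdivPoint k h t),
      p.length = t - s := by
  induction t, hst using Nat.le_induction with
  | base => exact ⟨Walk.nil, by simp⟩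
  | succ t hst ih =>
    obtain ⟨p, hp⟩ := ih (by omega)
    exact ⟨p.concat (subdivision_adj_subdivPoint h (by omega)), by
      rw [Walk.length_concat, hp]; omega⟩

lemma dist_subdivPoint_le_sub {a b : V} (h : G.Adj a b) {s t : ℕ} (hst : s ≤ t)
    (ht : t ≤ k + 1) :
    (G.subdivision k).dist (subdivPoint k h s) (subdivPoint k h t) ≤ t - s := by
  obtain ⟨p, hp⟩ := exists_walk_subdivPoint h hst ht
  exact hp ▸ dist_le p

lemma exists_walk_subdivision_inl (k : ℕ) {a b : V} (p : G.Walk a b) :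
    ∃ q : (G.subdivision k).Walk (Sum.inl a) (Sum.inl b),
      q.length = (k + 1) * p.length := by
  induction p with
  | nil => exact ⟨Walk.nil, by simp⟩
  | cons h p ih =>
    obtain ⟨q, hq⟩ := ih
    obtain ⟨r, hr⟩ := exists_walk_subdivPoint (k := k) h (Nat.zero_le (k + 1)) le_rfl
    refine ⟨(r.copy (subdivPoint_zero h) (subdivPoint_last h)).append q, ?_⟩
    rw [Walk.length_append, Walk.length_copy, hr, hq, Walk.length_cons, Nat.sub_zero]
    ring

lemma exists_walk_subdivPoint_subdivPoint (hG : G.Connected) {a b a' b' : V} (h : G.Adj a b)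
    (h' : G.Adj a' b') {s s' : ℕ} (hs : s ≤ k + 1) (hs' : s' ≤ k + 1) :
    ∃ p : (G.subdivision k).Walk (subdivPoint k h s) (subdivPoint k h' s'),
      p.length = s + (k + 1) * G.dist a a' + s' := by
  obtain ⟨w, hw⟩ := hG.exists_walk_length_eq_dist a a'
  obtain ⟨p, hp⟩ := exists_walk_subdivPoint h (Nat.zero_le s) hs
  obtain ⟨q, hq⟩ := exists_walk_subdivision_inl k w
  obtain ⟨r, hr⟩ := exists_walk_subdivPoint h' (Nat.zero_le s') hs'
  refine ⟨((p.copy (subdivPoint_zero h) rfl).reverse.append q).append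
    (r.copy (subdivPoint_zero h') rfl), ?_⟩
  simp [hp, hq, hr, hw]

lemma dist_subdivPoint_le (hG : G.Connected) {a b a' b' : V} (h : G.Adj a b)
    (h' : G.Adj a' b') {s s' : ℕ} (hs : s ≤ k + 1) (hs' : s' ≤ k + 1) :
    (G.subdivision k).dist (subdivPoint k h s) (subdivPoint k h' s') ≤
      s + (k + 1) * G.dist a a' + s' := by
  obtain ⟨p, hp⟩ := exists_walk_subdivPoint_subdivPoint hG h h' hs hs'
  exact hp ▸ dist_le p

/-- A function that changes by at most one along edges bounds the length of walks. -/
lemma Walk.le_add_length {X : Type*} {H : SimpleGraph X} {f : X → ℕ}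
    (hf : ∀ x y, H.Adj x y → f y ≤ f x + 1) {x y : X} (p : H.Walk x y) :
    f y ≤ f x + p.length := by
  induction p with
  | nil => simp
  | cons h p ih =>
    have := hf _ _ h
    rw [Walk.length_cons]
    omega

/-- Interpolation along subdivided edges of a function `g` on the original vertices; on the
edge `e₀` it is the distance to the point at position `s`. -/
def subdivPotential (k : ℕ) (g : V → ℕ) (e₀ : {e : V × V // e.1 < e.2 ∧ G.Adj e.1 e.2})
    (s : ℕ) : SubdivVert V k G → ℕ
  | Sum.inl v => g v
  | Sum.inr (e, i) =>
      if e = e₀ then (i + 1 - s) + (s - (i + 1)) else min (g e.1.1 + (i + 1)) (g e.1.2 + (k - i))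

lemma subdivPotential_le (g : V → ℕ) (hg : ∀ a b, G.Adj a b → g a ≤ g b + (k + 1))
    (e₀ : {e : V × V // e.1 < e.2 ∧ G.Adj e.1 e.2}) {s : ℕ} (hs : s ≤ k + 1)
    (h₁ : g e₀.1.1 = s) (h₂ : g e₀.1.2 = k + 1 - s) (x y : SubdivVert V k G)
    (hxy : (G.subdivision k).Adj x y) :
    subdivPotential k g e₀ s y ≤ subdivPotential k g e₀ s x + 1 := by
  have hL : ∀ e : {e : V × V // e.1 < e.2 ∧ G.Adj e.1 e.2},
      g e.1.1 ≤ g e.1.2 + (k + 1) ∧ g e.1.2 ≤ g e.1.1 + (k + 1) :=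
    fun e => ⟨hg _ _ e.2.2, hg _ _ e.2.2.symm⟩
  unfold subdivision at hxy
  rw [fromRel_adj] at hxy
  obtain ⟨-, hxy⟩ := hxy
  rcases x with a | ⟨e, i⟩ <;> rcases y with b | ⟨e', i'⟩ <;> simp only [subdivPotential]
  · rcases hxy with ⟨hab, hk⟩ | ⟨hab, hk⟩
    · have := hg _ _ hab.symm; omega
    · have := hg _ _ hab; omega
  · have := hL e'
    have := i'.2
    simp only [or_false] at hxy
    split_ifs with he
    · subst he
      rcases hxy with ⟨rfl, hi⟩ | ⟨rfl, hi⟩ <;> omega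
    · rcases hxy with ⟨rfl, hi⟩ | ⟨rfl, hi⟩ <;> omega
  · have := hL e
    have := i.2
    simp only [false_or] at hxy
    split_ifs with he
    · subst he
      rcases hxy with ⟨rfl, hi⟩ | ⟨rfl, hi⟩ <;> omega
    · rcases hxy with ⟨rfl, hi⟩ | ⟨rfl, hi⟩ <;> omega
  · have := i.2
    have := i'.2
    have hee : e = e' := by rcases hxy with h | h; exacts [h.1, h.1.symm]
    subst hee
    simp only [true_and] at hxy
    split_ifs <;> omega

lemma subdivPotential_subdivPoint (g : V → ℕ) (hg : ∀ a b, G.Adj a b → g a ≤ g b + (k + 1))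
    (e₀ : {e : V × V // e.1 < e.2 ∧ G.Adj e.1 e.2}) {s : ℕ} {a b : V} (h : G.Adj a b) {t : ℕ}
    (ht : t ≤ k + 1) (hne : s(a, b) ≠ s(e₀.1.1, e₀.1.2)) :
    subdivPotential k g e₀ s (subdivPoint k h t) = min (g a + t) (g b + (k + 1 - t)) := by
  have h1 := hg _ _ h
  have h2 := hg _ _ h.symm
  unfold subdivPoint
  split_ifs with h3 h4 h5
  · simp only [subdivPotential]; omega
  · simp only [subdivPotential]; omega
  · simp only [subdivPotential]
    rw [if_neg (by rintro rfl; exact hne rfl)]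
    omega
  · simp only [subdivPotential]
    rw [if_neg (by rintro rfl; exact hne Sym2.eq_swap)]
    omega

lemma subdivPotential_subdivPoint_self (g : V → ℕ) {a b : V} (h : G.Adj a b) (hab : a < b)
    {s : ℕ} (hs : s ≤ k + 1) (h₁ : g a = s) (h₂ : g b = k + 1 - s) :
    subdivPotential k g ⟨(a, b), hab, h⟩ s (subdivPoint k h s) = 0 := by
  unfold subdivPoint
  split_ifs with h3 h4
  · simp only [subdivPotential]; omega
  · simp only [subdivPotential]; omega
  · simp only [subdivPotential, if_true]; omega

lemma le_dist_subdivPoint (hG : G.Connected) {a b a' b' : V} (h : G.Adj a b)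
    (h' : G.Adj a' b') (hne : s(a, b) ≠ s(a', b')) {s s' : ℕ} (hs : s ≤ k + 1)
    (hs' : s' ≤ k + 1) :
    min (min (s + (k + 1) * G.dist a a' + s') (s + (k + 1) * G.dist a b' + (k + 1 - s')))
      (min ((k + 1 - s) + (k + 1) * G.dist b a' + s')
        ((k + 1 - s) + (k + 1) * G.dist b b' + (k + 1 - s'))) ≤
      (G.subdivision k).dist (subdivPoint k h s) (subdivPoint k h' s') := by
  wlog hab : a < b generalizing a b s
  · have := this h.symm (by rwa [Sym2.eq_swap]) (s := k + 1 - s) (by omega)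
      (lt_of_le_of_ne (not_lt.1 hab) h.ne')
    rw [subdivPoint_symm h hs] at this
    refine le_trans (le_of_eq ?_) this
    rw [min_comm, show k + 1 - (k + 1 - s) = s by omega]
  set g : V → ℕ := fun v => min (s + (k + 1) * G.dist a v) ((k + 1 - s) + (k + 1) * G.dist b v)
    with hgdef
  have hlip : ∀ u v w, G.Adj v w → (k + 1) * G.dist u v ≤ (k + 1) * G.dist u w + (k + 1) := by
    intro u v w hvw
    have : G.dist u v ≤ G.dist u w + 1 := by
      have := hG.dist_triangle (u := u) (v := w) (w := v)
      rwa [dist_eq_one_iff_adj.2 hvw.symm] at this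
    calc (k + 1) * G.dist u v ≤ (k + 1) * (G.dist u w + 1) := Nat.mul_le_mul_left _ this
      _ = _ := by ring
  have hg : ∀ v w, G.Adj v w → g v ≤ g w + (k + 1) := by
    intro v w hvw
    have := hlip a v w hvw
    have := hlip b v w hvw
    simp only [hgdef]
    omega
  have h₁ : g a = s := by
    simp only [hgdef, dist_self, dist_eq_one_iff_adj.2 h.symm]; omega
  have h₂ : g b = k + 1 - s := by
    simp only [hgdef, dist_self, dist_eq_one_iff_adj.2 h]; omega
  obtain ⟨p, -⟩ := exists_walk_subdivPoint_subdivPoint hG h h' hs hs'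
  obtain ⟨q, hq⟩ := p.reachable.exists_walk_length_eq_dist
  have hle := q.le_add_length (subdivPotential_le g hg ⟨(a, b), hab, h⟩ hs h₁ h₂)
  rw [subdivPotential_subdivPoint_self g h hab hs h₁ h₂,
    subdivPotential_subdivPoint g hg _ h' hs' hne.symm, hq] at hle
  simp only [hgdef] at hle
  omega

lemma le_dist_subdivPoint_of_le (hG : G.Connected) {a b a' b' : V} (h : G.Adj a b)
    (h' : G.Adj a' b') (hne : s(a, b) ≠ s(a', b')) {s s' n : ℕ} (hs : s ≤ k + 1)
    (hs' : s' ≤ k + 1) (h₁ : n ≤ s + (k + 1) * G.dist a a' + s')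
    (h₂ : n ≤ s + (k + 1) * G.dist a b' + (k + 1 - s'))
    (h₃ : n ≤ (k + 1 - s) + (k + 1) * G.dist b a' + s')
    (h₄ : n ≤ (k + 1 - s) + (k + 1) * G.dist b b' + (k + 1 - s')) :
    n ≤ (G.subdivision k).dist (subdivPoint k h s) (subdivPoint k h' s') :=
  le_trans (le_min (le_min h₁ h₂) (le_min h₃ h₄)) (le_dist_subdivPoint hG h h' hne hs hs')

end Subdivision

section Energy

variable {X : Type*}

lemma exists_finsupp_energy_pos_of_family {ι : Type*} [Fintype ι] (d : X → X → ℝ) (z : ι → X)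
    (a : ι → ℝ) (ha : ∑ i, a i = 0) (hpos : 0 < ∑ i, ∑ j, a i * a j * d (z i) (z j)) :
    ∃ ω : X →₀ ℝ, (∑ x ∈ ω.support, ω x) = 0 ∧
      0 < ∑ x ∈ ω.support, ∑ y ∈ ω.support, ω x * ω y * d x y := by
  have key : ∀ f : X → ℝ, ∑ x ∈ (∑ i, Finsupp.single (z i) (a i)).support,
      (∑ i, Finsupp.single (z i) (a i)) x * f x = ∑ i, a i * f (z i) := by
    intro f
    change Finsupp.sum (∑ i, Finsupp.single (z i) (a i)) (fun x r => r * f x) = _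
    rw [← Finsupp.sum_finsetSum_index (fun _ => zero_mul _) (fun _ _ _ => add_mul _ _ _)]
    exact Finset.sum_congr rfl fun i _ => Finsupp.sum_single_index (zero_mul _)
  refine ⟨∑ i, Finsupp.single (z i) (a i), ?_, ?_⟩
  · simpa [ha] using key fun _ => 1
  · have h : ∀ x, ∑ y ∈ (∑ i, Finsupp.single (z i) (a i)).support,
        (∑ i, Finsupp.single (z i) (a i)) x * (∑ i, Finsupp.single (z i) (a i)) y * d x y =
        (∑ i, Finsupp.single (z i) (a i)) x * ∑ j, a j * d x (z j) := by
      intro x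
      rw [← key, Finset.mul_sum]
      exact Finset.sum_congr rfl fun y _ => mul_assoc _ _ _
    rw [Finset.sum_congr rfl fun x _ => h x, key fun x => ∑ j, a j * d x (z j)]
    simpa [Finset.mul_sum, mul_assoc] using hpos

/-- Failure of the hexagonal inequality, with weight `1` at `x₁, x₂, x₃` and `-1` at
`y₁, y₂, y₃`. -/
lemma exists_finsupp_energy_pos (H : SimpleGraph X) {x₁ x₂ x₃ y₁ y₂ y₃ : X}
    (h : H.dist x₁ y₁ + H.dist x₁ y₂ + H.dist x₁ y₃ + H.dist x₂ y₁ + H.dist x₂ y₂ +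
      H.dist x₂ y₃ + H.dist x₃ y₁ + H.dist x₃ y₂ + H.dist x₃ y₃ <
      H.dist x₁ x₂ + H.dist x₁ x₃ + H.dist x₂ x₃ +
      (H.dist y₁ y₂ + H.dist y₁ y₃ + H.dist y₂ y₃)) :
    ∃ ω : X →₀ ℝ, (∑ x ∈ ω.support, ω x) = 0 ∧
      0 < ∑ x ∈ ω.support, ∑ y ∈ ω.support, ω x * ω y * (H.dist x y : ℝ) := by
  have h' := (Nat.cast_lt (α := ℝ)).2 h
  push_cast at h'
  refine exists_finsupp_energy_pos_of_family (fun x y => (H.dist x y : ℝ))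
    ![x₁, x₂, x₃, y₁, y₂, y₃] ![1, 1, 1, -1, -1, -1] (by simp [Fin.sum_univ_succ]) ?_
  simp only [Fin.sum_univ_six, Matrix.cons_val, dist_self]
  rw [H.dist_comm (u := x₂) (v := x₁), H.dist_comm (u := x₃) (v := x₁),
    H.dist_comm (u := x₃) (v := x₂), H.dist_comm (u := y₂) (v := y₁),
    H.dist_comm (u := y₃) (v := y₁), H.dist_comm (u := y₃) (v := y₂),
    H.dist_comm (u := y₁) (v := x₁), H.dist_comm (u := y₁) (v := x₂),
    H.dist_comm (u := y₁) (v := x₃), H.dist_comm (u := y₂) (v := x₁),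
    H.dist_comm (u := y₂) (v := x₂), H.dist_comm (u := y₂) (v := x₃),
    H.dist_comm (u := y₃) (v := x₁), H.dist_comm (u := y₃) (v := x₂),
    H.dist_comm (u := y₃) (v := x₃)]
  push_cast
  linarith

end Energy

section Configuration

variable {V : Type*} [LinearOrder V] {G : SimpleGraph V}

/-- Two opposite edges `aa'` and `bb'` of an isometric cycle of length `2 * (i + 1 + j) + f`, at
distances `i` and `j` from a vertex `u` of the cycle, together with an edge `ww'` such that
geodesics from `w` to the cycle may be assumed to enter it at `u`, whereas from points beyond
position `181 * e / 2` on `ww'` the vertex `a'` has a shortcut and `a` does not. -/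
lemma exists_energy_pos_of_opposite_edges (hG : G.Connected) {a a' b b' w w' : V}
    (ha : G.Adj a a') (hb : G.Adj b b') (hw : G.Adj w w') (hab : s(a, a') ≠ s(b, b'))
    (hwa : s(w, w') ≠ s(a, a')) (hwb : s(w, w') ≠ s(b, b')) {i j f A e : ℕ}
    (hf : f ≤ 1) (he : e ≤ 1)
    (dab : G.dist a b = i + j) (dab' : G.dist a b' = i + j + 1) (da'b : G.dist a' b = i + j + 1)
    (da'b' : G.dist a' b' = i + j + f)
    (dwa : G.dist w a = A + i) (dwa' : G.dist w a' = A + (i + 1))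
    (dwb : G.dist w b = A + j) (dwb' : G.dist w b' = A + (j + 1))
    (dw'a : A + i + e ≤ G.dist w' a) (dw'a' : G.dist w' a' = A + i + e)
    (dw'b : A + j + e ≤ G.dist w' b + 1) (dw'b' : A + j + e ≤ G.dist w' b') :
    ∃ ω : SubdivVert V 180 G →₀ ℝ, (∑ x ∈ ω.support, ω x) = 0 ∧
      0 < ∑ x ∈ ω.support, ∑ y ∈ ω.support,
          ω x * ω y * ((G.subdivision 180).dist x y : ℝ) := by
  obtain ⟨σ, hσ⟩ : ∃ σ, σ = 90 * f := ⟨_, rfl⟩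
  have m₁ : 181 * (i + j + 1) + σ ≤
      (G.subdivision 180).dist (subdivPoint 180 ha 181) (subdivPoint 180 hb σ) :=
    le_dist_subdivPoint_of_le hG ha hb hab (by omega) (by clear * - hf hσ; omega)
      (by rw [dab]; clear * - hf hσ; omega) (by rw [dab']; clear * - hf hσ; omega)
      (by rw [da'b]; clear * - hf hσ; omega) (by rw [da'b']; clear * - hf hσ; omega)
  have m₂ : 181 * (i + j + 1) + σ ≤
      (G.subdivision 180).dist (subdivPoint 180 ha 176) (subdivPoint 180 hb (σ + 5)) :=
    le_dist_subdivPoint_of_le hG ha hb hab (by omega) (by clear * - hf hσ; omega)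
      (by rw [dab]; clear * - hf hσ; omega) (by rw [dab']; clear * - hf hσ; omega)
      (by rw [da'b]; clear * - hf hσ; omega) (by rw [da'b']; clear * - hf hσ; omega)
  have m₃ : 90 * e + 181 * (A + i + 1) ≤
      (G.subdivision 180).dist (subdivPoint 180 hw (90 * e)) (subdivPoint 180 ha 181) :=
    le_dist_subdivPoint_of_le hG hw ha hwa (by clear * - he; omega) (by omega)
      (by rw [dwa]; clear * - he; omega) (by rw [dwa']; clear * - he; omega)
      (by clear * - he dw'a; omega) (by rw [dw'a']; clear * - he; omega)
  have m₄ : 90 * e + 181 * (A + j) + σ ≤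
      (G.subdivision 180).dist (subdivPoint 180 hw (90 * e)) (subdivPoint 180 hb σ) :=
    le_dist_subdivPoint_of_le hG hw hb hwb (by clear * - he; omega) (by clear * - hf hσ; omega)
      (by rw [dwb]) (by rw [dwb']; clear * - hf hσ; omega)
      (by clear * - he dw'b; omega) (by clear * - he hf hσ dw'b'; omega)
  have m₅ : 90 * e + 181 * (A + i + 1) ≤
      (G.subdivision 180).dist (subdivPoint 180 hw (90 * e + 5)) (subdivPoint 180 ha 176) :=
    le_dist_subdivPoint_of_le hG hw ha hwa (by clear * - he; omega) (by omega)
      (by rw [dwa]; clear * - he; omega) (by rw [dwa']; clear * - he; omega)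
      (by clear * - he dw'a; omega) (by rw [dw'a']; clear * - he; omega)
  obtain ⟨D, hD, hD', hD''⟩ : ∃ D, D ≤ 90 * e + 5 + 181 * (A + j) ∧
      D ≤ 181 - (90 * e + 5) + 181 * G.dist w' b ∧
      (D = 90 * e + 5 + 181 * (A + j) ∨ D = 181 - (90 * e + 5) + 181 * G.dist w' b) :=
    ⟨_, min_le_left _ _, min_le_right _ _, min_choice _ _⟩
  have m₆ : D + σ + 5 ≤
      (G.subdivision 180).dist (subdivPoint 180 hw (90 * e + 5)) (subdivPoint 180 hb (σ + 5)) :=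
    le_dist_subdivPoint_of_le hG hw hb hwb (by clear * - he; omega) (by clear * - hf hσ; omega)
      (by rw [dwb]; clear * - hD; omega) (by rw [dwb']; clear * - hf hσ hD; omega)
      (by clear * - hD'; omega) (by clear * - he hf hσ hD dw'b'; omega)
  have u₁ := dist_subdivPoint_le_sub (k := 180) ha (s := 176) (t := 181) (by omega) (by omega)
  have u₂ := dist_subdivPoint_le_sub (k := 180) hb (s := σ) (t := σ + 5) (by omega)
    (by clear * - hf hσ; omega)
  have u₃ := dist_subdivPoint_le_sub (k := 180) hw (s := 90 * e) (t := 90 * e + 5)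
    (by omega) (by clear * - he; omega)
  have u₄ := dist_subdivPoint_le (k := 180) hG ha.symm hb.symm (s := 0) (s' := 181 - (σ + 5))
    (by omega) (by omega)
  have u₅ := dist_subdivPoint_le (k := 180) hG hb ha (s := σ) (s' := 176)
    (by clear * - hf hσ; omega) (by omega)
  have u₆ := dist_subdivPoint_le (k := 180) hG hw ha (s := 90 * e) (s' := 176)
    (by clear * - he; omega) (by omega)
  have u₇ := dist_subdivPoint_le (k := 180) hG hw hb (s := 90 * e) (s' := σ + 5)
    (by clear * - he; omega) (by clear * - hf hσ; omega)
  have u₈ := dist_subdivPoint_le (k := 180) hG hw.symm ha.symm (s := 181 - (90 * e + 5)) (s' := 0)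
    (by omega) (by omega)
  have u₉ : (G.subdivision 180).dist (subdivPoint 180 hw (90 * e + 5)) (subdivPoint 180 hb σ) ≤
      D + σ := by
    rcases hD'' with h | h
    · rw [h, ← dwb]
      exact dist_subdivPoint_le hG hw hb (by clear * - he; omega) (by clear * - hf hσ; omega)
    · rw [h, ← subdivPoint_symm hw (by clear * - he; omega)]
      exact dist_subdivPoint_le hG hw.symm hb (by omega) (by clear * - hf hσ; omega)
  have s₁ : subdivPoint 180 ha.symm 0 = subdivPoint 180 ha 181 :=
    subdivPoint_symm (k := 180) ha (s := 181) (by omega)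
  have s₂ := subdivPoint_symm (k := 180) hb (s := σ + 5) (by clear * - hf hσ; omega)
  have s₃ := subdivPoint_symm (k := 180) hw (s := 90 * e + 5) (by clear * - he; omega)
  rw [s₁, s₂, da'b'] at u₄
  rw [s₃, s₁, dw'a'] at u₈
  rw [dist_comm] at u₁
  rw [dist_comm (u := b), dab] at u₅
  rw [dwa] at u₆
  rw [dwb] at u₇
  apply exists_finsupp_energy_pos (G.subdivision 180)
    (x₁ := subdivPoint 180 hw (90 * e)) (x₂ := subdivPoint 180 ha 181) (x₃ := subdivPoint 180 hb σ)
    (y₁ := subdivPoint 180 hw (90 * e + 5)) (y₂ := subdivPoint 180 ha 176)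
    (y₃ := subdivPoint 180 hb (σ + 5))
  rw [dist_comm (u := subdivPoint 180 ha 181) (v := subdivPoint 180 hw (90 * e + 5)),
    dist_comm (u := subdivPoint 180 hb σ) (v := subdivPoint 180 hw (90 * e + 5))]
  clear * - hf he hσ hD m₁ m₂ m₃ m₄ m₅ m₆ u₁ u₂ u₃ u₄ u₅ u₆ u₇ u₈ u₉
  omega

end Configuration

section IsometricCycle

variable {V : Type*} [LinearOrder V] {G : SimpleGraph V}

/-- Here `w` is a vertex whose geodesics to the cycle `c` may be assumed to enter it at `c 0`,
and `w'` is a neighbour of `w` for which this fails. -/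
lemma exists_energy_pos_of_shortcut (hG : G.Connected) {m : ℕ} (hm : 3 ≤ m) {c : ℤ → V}
    (hper : Function.Periodic c m) (hadj : ∀ t, G.Adj (c t) (c (t + 1)))
    (hiso : ∀ (t : ℤ) (n : ℕ), 2 * n ≤ m → G.dist (c t) (c (t + n)) = n) {w w' : V}
    (hw : G.Adj w w') (hww' : ∀ t, s(w, w') ≠ s(c t, c (t + 1))) {A e : ℕ} (he : e ≤ 1)
    (hgate : ∀ t, G.dist w (c t) = A + G.dist (c 0) (c t))
    (hmin : ∀ t, A + G.dist (c 0) (c t) + e ≤ G.dist w' (c t) + 1)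
    (h0 : A + e < G.dist w' (c 0) + 1)
    (hn : ∃ n : ℕ, 2 * n ≤ m ∧ G.dist w' (c n) + 1 = A + n + e) :
    ∃ ω : SubdivVert V 180 G →₀ ℝ, (∑ x ∈ ω.support, ω x) = 0 ∧
      0 < ∑ x ∈ ω.support, ∑ y ∈ ω.support,
          ω x * ω y * ((G.subdivision 180).dist x y : ℝ) := by
  have hpos : ∀ n : ℕ, 2 * n ≤ m → G.dist (c 0) (c n) = n := by
    intro n hn
    simpa using hiso 0 n hn
  have hneg : ∀ n : ℕ, 2 * n ≤ m → G.dist (c 0) (c (-n)) = n := by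
    intro n hn
    simpa [dist_comm] using hiso (-n) n hn
  classical
  obtain ⟨hi, hi'⟩ := Nat.find_spec hn
  obtain ⟨i, hfind⟩ : ∃ i, Nat.find hn = i + 1 := by
    refine Nat.exists_eq_succ_of_ne_zero fun h => ?_
    rw [h] at hi'
    simp only [Nat.cast_zero] at hi'
    omega
  have hlt := Nat.find_min hn (m := i) (by omega)
  rw [hfind] at hi hi'
  obtain ⟨j, f, hmij, hf⟩ : ∃ j f, m = 2 * (i + j + 1) + f ∧ f ≤ 1 :=
    ⟨m / 2 - 1 - i, m % 2, by omega, by omega⟩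
  have hdist : ∀ (s t : ℤ) (n : ℕ), s + n = t → 2 * n ≤ m → G.dist (c s) (c t) = n := by
    rintro s t n rfl h
    exact hiso s n h
  have hbb' : (-((j + 1 : ℕ) : ℤ)) + 1 = -(j : ℤ) := by push_cast; ring
  have hb := hadj (-((j + 1 : ℕ) : ℤ))
  have hwb := hww' (-((j + 1 : ℕ) : ℤ))
  rw [hbb'] at hb hwb
  rw [Sym2.eq_swap (a := c (-((j + 1 : ℕ) : ℤ)))] at hwb
  have ha : G.Adj (c i) (c (i + 1 : ℕ)) := hadj i
  have hwa : s(w, w') ≠ s(c i, c (i + 1 : ℕ)) := hww' i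
  have dab : G.dist (c i) (c (-(j : ℤ))) = i + j := by
    rw [dist_comm]
    exact hdist _ _ _ (by push_cast; ring) (by omega)
  have dab' : G.dist (c i) (c (-((j + 1 : ℕ) : ℤ))) = i + j + 1 := by
    rw [dist_comm]
    exact hdist _ _ _ (by push_cast; ring) (by omega)
  have da'b : G.dist (c (i + 1 : ℕ)) (c (-(j : ℤ))) = i + j + 1 := by
    rw [dist_comm]
    exact hdist _ _ _ (by push_cast; ring) (by omega)
  have da'b' : G.dist (c (i + 1 : ℕ)) (c (-((j + 1 : ℕ) : ℤ))) = i + j + f := by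
    rw [← hper (-((j + 1 : ℕ) : ℤ))]
    exact hdist _ _ _ (by rw [hmij]; push_cast; ring) (by omega)
  have hai := hpos i (by omega)
  have hai' := hpos (i + 1) (by omega)
  have hbj := hneg j (by omega)
  have hbj' := hneg (j + 1) (by omega)
  have hab : s(c i, c (i + 1 : ℕ)) ≠ s(c (-(j : ℤ)), c (-((j + 1 : ℕ) : ℤ))) := by
    intro h
    rcases Sym2.eq_iff.1 h with ⟨h₁, h₂⟩ | ⟨h₁, h₂⟩
    · rw [h₁, dist_self] at dab
      rw [h₂, dist_self] at da'b'
      omega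
    · rw [h₁, dist_self] at dab'
      omega
  have hmin₁ := hmin i
  have hmin₂ := hmin (-(j : ℤ))
  have hmin₃ := hmin (-((j + 1 : ℕ) : ℤ))
  rw [hai] at hmin₁
  rw [hbj] at hmin₂
  rw [hbj'] at hmin₃
  refine exists_energy_pos_of_opposite_edges hG ha hb.symm hw hab hwa hwb hf he dab dab' da'b
    da'b' (A := A) ?_ ?_ ?_ ?_ ?_ ?_ ?_ ?_
  · rw [hgate, hai]
  · rw [hgate, hai']
  · rw [hgate, hbj]
  · rw [hgate, hbj']
  · have : ¬ G.dist w' (c i) + 1 = A + i + e := fun h => hlt ⟨by omega, h⟩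
    omega
  · omega
  · omega
  · omega

/-- The conclusion holds if some walk joins two vertices of an isometric cycle without using
the edges of the cycle. -/
lemma exists_energy_pos_of_isometric_cycle (hG : G.Connected) {m : ℕ} (hm : 3 ≤ m) {c : ℤ → V}
    (hper : Function.Periodic c m) (hadj : ∀ t, G.Adj (c t) (c (t + 1)))
    (hiso : ∀ (t : ℤ) (n : ℕ), 2 * n ≤ m → G.dist (c t) (c (t + n)) = n) {t₀ : ℤ}
    (hne : c 0 ≠ c t₀)
    (hreach : (G.deleteEdges (Set.range fun t => s(c t, c (t + 1)))).Reachable (c 0) (c t₀)) :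
    ∃ ω : SubdivVert V 180 G →₀ ℝ, (∑ x ∈ ω.support, ω x) = 0 ∧
      0 < ∑ x ∈ ω.support, ∑ y ∈ ω.support,
          ω x * ω y * ((G.subdivision 180).dist x y : ℝ) := by
  obtain ⟨p⟩ := hreach
  obtain ⟨d, -, hd, hd'⟩ := p.exists_boundary_dart
    {w | ∀ t, G.dist w (c t) = G.dist w (c 0) + G.dist (c 0) (c t)} (by simp)
    (by
      intro h
      have h₁ := h t₀
      rw [dist_self, dist_comm (u := c t₀)] at h₁
      exact hne (hG.dist_eq_zero_iff.1 (by omega)))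
  obtain ⟨⟨w, w'⟩, hww'⟩ := d
  simp only [Set.mem_ofPred_eq, not_forall] at hd hd'
  obtain ⟨t₂, ht₂⟩ := hd'
  rw [deleteEdges_adj] at hww'
  obtain ⟨hw, hww'⟩ := hww'
  replace hww' : ∀ t, s(w, w') ≠ s(c t, c (t + 1)) := fun t h => hww' ⟨t, h.symm⟩
  have hw1 : G.dist w w' = 1 := dist_eq_one_iff_adj.2 hw
  have hlow : ∀ t, G.dist w (c 0) + G.dist (c 0) (c t) ≤ G.dist w' (c t) + 1 := by
    intro t
    have := hG.dist_triangle (u := w) (v := w') (w := c t)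
    rw [← hd]
    omega
  have hup := hG.dist_triangle (u := w') (v := w) (w := c 0)
  rw [dist_comm (u := w') (v := w), hw1] at hup
  have htri := hG.dist_triangle (u := w') (v := c 0) (w := c t₂)
  let β : ℤ → ℕ := fun t => G.dist w' (c t) + 1 - (G.dist w (c 0) + G.dist (c 0) (c t))
  obtain ⟨t₁, ht₁⟩ : ∃ t₁, ∀ t, β t₁ ≤ β t :=
    ⟨Function.argmin β, fun t => Function.argmin_le β t⟩
  obtain ⟨e, hβ⟩ : ∃ e, e = β t₁ := ⟨_, rfl⟩
  have hmin : ∀ t, G.dist w (c 0) + G.dist (c 0) (c t) + e ≤ G.dist w' (c t) + 1 := by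
    intro t
    have h₁ := ht₁ t
    have h₂ := hlow t
    simp only [β] at h₁ hβ
    omega
  have heq : G.dist w' (c t₁) + 1 = G.dist w (c 0) + G.dist (c 0) (c t₁) + e := by
    have h₂ := hlow t₁
    simp only [β] at hβ
    omega
  have hmin₂ := hmin t₂
  have h0 : G.dist w (c 0) + e < G.dist w' (c 0) + 1 := by omega
  have he : e ≤ 1 := by omega
  have hc : ∀ t, c (t % m) = c t := by
    intro t
    rw [Int.emod_def, mul_comm]
    exact hper.sub_int_mul_eq _
  have hm0 : (0 : ℤ) < m := by omega
  have hr := Int.emod_nonneg t₁ hm0.ne'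
  have hr' := Int.emod_lt_of_pos t₁ hm0
  obtain ⟨r, hrt⟩ := Int.eq_ofNat_of_zero_le hr
  rw [← hc, hrt] at heq
  rw [hrt] at hr'
  rcases le_or_gt (2 * r) m with h | h
  · refine exists_energy_pos_of_shortcut hG hm hper hadj hiso hw hww' he hd hmin h0 ⟨r, h, ?_⟩
    have := hiso 0 r h
    rw [zero_add] at this
    rw [heq, this]
  · have hsm : 2 * (m - r) ≤ m := by omega
    have hcs : c (-((m - r : ℕ) : ℤ)) = c r := by
      rw [← hper]
      congr 1
      omega
    refine exists_energy_pos_of_shortcut hG hm (c := fun t => c (-t)) (A := G.dist w (c 0))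
      ?_ ?_ ?_ hw ?_ he ?_ ?_ ?_ ⟨m - r, hsm, ?_⟩
    · intro t
      simp only
      rw [← hper, neg_add, neg_add_cancel_right]
    · intro t
      have := hadj (-(t + 1))
      rw [neg_add, neg_add_cancel_right] at this
      simpa only [neg_add] using this.symm
    · intro t n hn
      have := hiso (-(t + n)) n hn
      rw [neg_add, neg_add_cancel_right] at this
      simpa only [neg_add, dist_comm (u := c (-t))] using this
    · intro t
      have := hww' (-(t + 1))
      rw [neg_add, neg_add_cancel_right, Sym2.eq_swap (a := c _)] at this
      simpa only [neg_add] using this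
    · intro t
      simpa using hd (-t)
    · intro t
      simpa using hmin (-t)
    · simpa using h0
    · simp only
      rw [hcs, heq]
      have := hiso (-((m - r : ℕ) : ℤ)) _ hsm
      rw [neg_add_cancel, hcs, dist_comm] at this
      rw [this]

end IsometricCycle

section Detour

variable {V : Type*} {G : SimpleGraph V}

/-- Two distinct vertices of `p` are joined by a walk using no edge of `p`. -/
def Walk.HasDetour {u v : V} (p : G.Walk u v) : Prop :=
  ∃ x ∈ p.support, ∃ y ∈ p.support, x ≠ y ∧ (G.deleteEdges {e | e ∈ p.edges}).Reachable x y

lemma exists_walk_of_adj_succ {c : ℤ → V} (hadj : ∀ t, G.Adj (c t) (c (t + 1))) (s : ℤ) (n : ℕ) :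
    ∃ p : G.Walk (c s) (c (s + n)), p.length = n ∧
      p.support = (List.range (n + 1)).map (fun i : ℕ => c (s + i)) ∧
      p.edges = (List.range n).map (fun i : ℕ => s(c (s + i), c (s + i + 1))) := by
  induction n with
  | zero => exact ⟨Walk.nil.copy rfl (by simp), by simp, by simp, by simp⟩
  | succ n ih =>
    obtain ⟨p, hl, hs, he⟩ := ih
    have hc : c (s + n + 1) = c (s + (n + 1 : ℕ)) := by push_cast; rw [add_assoc]
    refine ⟨(p.concat (hadj _)).copy rfl hc, by simp [hl], ?_, ?_⟩
    · rw [Walk.support_copy, Walk.support_concat, hs, List.range_succ (n := n + 1),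
        List.map_append, hc]
      rfl
    · rw [Walk.edges_copy, Walk.edges_concat, he, List.range_succ (n := n), List.map_append,
        List.concat_eq_append]
      rfl

/-- A shortest cycle with a detour is isometric. -/
lemma dist_eq_of_forall_isCycle_le_length (hG : G.Connected) {m : ℕ} (hm : 3 ≤ m) {c : ℤ → V}
    (hper : Function.Periodic c m) (hadj : ∀ t, G.Adj (c t) (c (t + 1)))
    (hinj : ∀ s t, c s = c t → (m : ℤ) ∣ t - s)
    (hmin : ∀ (u : V) (p : G.Walk u u), p.IsCycle → p.HasDetour → m ≤ p.length) (s : ℤ) (n : ℕ)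
    (hn : 2 * n ≤ m) : G.dist (c s) (c (s + n)) = n := by
  have hle : ∀ (s : ℤ) (n : ℕ), G.dist (c s) (c (s + n)) ≤ n := by
    intro s n
    obtain ⟨p, hp, -⟩ := exists_walk_of_adj_succ hadj s n
    exact (dist_le p).trans_eq hp
  have hper' : ∀ k t : ℤ, c (t + k * m) = c t := fun k t => by simpa using hper.int_mul k t
  have hinj' : ∀ (s : ℤ) (i j : ℕ), c (s + i) = c (s + j) → i < j → j < i + m → False := by
    intro s i j h h₁ h₂
    have h₃ := Int.le_of_dvd (by omega) (hinj _ _ h)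
    omega
  refine le_antisymm (hle s n) ?_
  induction hd : G.dist (c s) (c (s + n)) using Nat.strong_induction_on generalizing s n with
  | _ d ih =>
  by_contra! hlt
  have hrep : ∀ s t : ℤ, G.dist (c s) (c t) < d →
      ∃ k : ℤ, |t - s - k * m| ≤ G.dist (c s) (c t) := by
    intro s t hst
    have hr := Int.emod_nonneg (t - s) (b := m) (by omega)
    have hr' := Int.emod_lt_of_pos (t - s) (b := m) (by omega)
    have hdiv := Int.emod_add_mul_ediv (t - s) m
    obtain ⟨r, hrt⟩ := Int.eq_ofNat_of_zero_le hr
    rw [hrt] at hr' hdiv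
    rcases le_or_gt (2 * r) m with h | h
    · refine ⟨(t - s) / m, ?_⟩
      have hc : c (s + r) = c t := by
        rw [← hper' ((t - s) / m) (s + r)]
        congr 1
        linarith
      have := ih _ hst s r h (by rw [hc])
      rw [show t - s - (t - s) / m * m = r by linarith, abs_of_nonneg (by positivity)]
      exact_mod_cast this
    · refine ⟨(t - s) / m + 1, ?_⟩
      have hc : c (t + (m - r : ℕ)) = c s := by
        rw [← hper' ((t - s) / m + 1) s]
        congr 1
        push_cast [show r ≤ m by omega]
        linarith
      have := ih _ hst t (m - r) (by omega) (by rw [hc, dist_comm])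
      rw [show t - s - ((t - s) / m + 1) * m = -((m - r : ℕ) : ℤ) by
        push_cast [show r ≤ m by omega]; linarith, abs_neg, abs_of_nonneg (by positivity)]
      exact_mod_cast this
  obtain ⟨q, hq, hql⟩ := hG.exists_path_of_dist (c s) (c (s + n))
  have hxy : c s ≠ c (s + n) := by
    intro h
    exact hinj' s 0 n (by simpa using h) (by omega) (by omega)
  have hd0 : 0 < d := by rw [← hd]; exact hG.pos_dist_of_ne hxy
  have hmem : ∀ r, c r ∈ q.support → c r = c s ∨ c r = c (s + n) := by
    intro r hr
    by_contra! hne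
    obtain ⟨q₁, q₂, rfl⟩ := Walk.mem_support_iff_exists_append.1 hr
    have h₁ := dist_le q₁
    have h₂ := dist_le q₂
    rw [Walk.length_append] at hql
    have h₃ := hG.pos_dist_of_ne hne.1.symm
    have h₄ := hG.pos_dist_of_ne hne.2
    obtain ⟨k₁, hk₁⟩ := hrep s r (by omega)
    obtain ⟨k₂, hk₂⟩ := hrep r (s + n) (by omega)
    rw [abs_le] at hk₁ hk₂
    have h₅ : (k₁ + k₂) * (m : ℤ) = k₁ * m + k₂ * m := add_mul _ _ _
    rcases lt_trichotomy (k₁ + k₂) 0 with hk | hk | hk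
    · have : (k₁ + k₂) * (m : ℤ) ≤ (-1) * m := mul_le_mul_of_nonneg_right (by omega) (by omega)
      omega
    · rw [hk, zero_mul] at h₅
      omega
    · have : 1 * (m : ℤ) ≤ (k₁ + k₂) * m := mul_le_mul_of_nonneg_right (by omega) (by omega)
      omega
  obtain ⟨p₁, -, -, hp₁e⟩ := exists_walk_of_adj_succ hadj s n
  obtain ⟨p₂, hp₂, hp₂s, hp₂e⟩ := exists_walk_of_adj_succ hadj (s + n) (m - n)
  have hclose : c (s + n + (m - n : ℕ)) = c s := by
    rw [← hper s]
    congr 1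
    omega
  obtain ⟨p₃, rfl⟩ : ∃ p₃ : G.Walk (c (s + n)) (c s), p₂ = p₃.copy rfl hclose.symm :=
    ⟨p₂.copy rfl hclose, by simp⟩
  rw [Walk.length_copy] at hp₂
  rw [Walk.support_copy] at hp₂s
  rw [Walk.edges_copy] at hp₂e
  have hp₂p : p₃.IsPath := by
    rw [Walk.isPath_def, hp₂s]
    refine List.Nodup.map_on ?_ List.nodup_range
    intro i hi j hj hij
    rw [List.mem_range] at hi hj
    rcases lt_trichotomy i j with h | h | h
    · exact (hinj' _ _ _ hij h (by omega)).elim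
    · exact h
    · exact (hinj' _ _ _ hij.symm h (by omega)).elim
  have hdisj : q.support.tail.Disjoint p₃.support.tail := by
    intro z hz hz'
    rw [hp₂s, List.range_succ_eq_map, List.map_cons, List.tail_cons, List.map_map,
      List.mem_map] at hz'
    obtain ⟨i, hi, rfl⟩ := hz'
    rw [List.mem_range] at hi
    simp only [Function.comp_apply] at hz
    rcases hmem _ (List.mem_of_mem_tail hz) with h | h
    · rw [h] at hz
      have := hq.support_nodup
      rw [← Walk.cons_tail_support] at this
      exact (List.nodup_cons.1 this).1 hz
    · exact hinj' (s + n) 0 i.succ (by simpa using h.symm) (by omega) (by omega)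
  have hcyc : (q.append p₃).IsCycle := hq.isCycle_append hp₂p hdisj (Or.inr (by omega))
  have hlen := hmin _ _ hcyc ⟨c s, by simp, c (s + n), by simp, hxy, ?_⟩
  · rw [Walk.length_append] at hlen
    omega
  refine ⟨p₁.toDeleteEdges _ fun e he he' => ?_⟩
  rw [hp₁e, List.mem_map] at he
  obtain ⟨i, hi, rfl⟩ := he
  rw [List.mem_range] at hi
  have hc : c (s + i + 1) = c (s + (i + 1 : ℕ)) := by push_cast; rw [add_assoc]
  rw [Set.mem_ofPred_eq, Walk.edges_append, List.mem_append, hc] at he'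
  rcases he' with he' | he'
  · have h₁ := hmem _ (q.fst_mem_support_of_mem_edges he')
    have h₂ := hmem _ (q.snd_mem_support_of_mem_edges he')
    have h₃ : i = 0 := by
      by_contra h
      rcases h₁ with h₁ | h₁
      · exact hinj' s 0 i (by simpa using h₁.symm) (by omega) (by omega)
      · exact hinj' s i n h₁ hi (by omega)
    have h₄ : i + 1 = n := by
      by_contra h
      rcases h₂ with h₂ | h₂
      · exact hinj' s 0 (i + 1) (by simpa using h₂.symm) (by omega) (by omega)
      · exact hinj' s (i + 1) n h₂ (by omega) (by omega)
    omega
  · rw [hp₂e, List.mem_map] at he'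
    obtain ⟨j, hj, hij⟩ := he'
    rw [List.mem_range] at hj
    have h₁ : s + n + j = s + (n + j : ℕ) := by push_cast; ring
    have h₂ : s + n + j + 1 = s + (n + j + 1 : ℕ) := by push_cast; ring
    rw [h₂, h₁] at hij
    rcases Sym2.eq_iff.1 hij with ⟨h, -⟩ | ⟨h, h'⟩
    · exact hinj' s i (n + j) h.symm (by omega) (by omega)
    · rcases Nat.eq_zero_or_pos i with hi₀ | hi₀
      · exact hinj' s (i + 1) (n + j) h.symm (by omega) (by omega)
      · exact hinj' s i (n + j + 1) h'.symm (by omega) (by omega)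

lemma Walk.exists_int_of_isCycle {u : V} {p : G.Walk u u} (hp : p.IsCycle) :
    ∃ c : ℤ → V, Function.Periodic c p.length ∧ (∀ t, G.Adj (c t) (c (t + 1))) ∧
      (∀ s t, c s = c t → (p.length : ℤ) ∣ t - s) ∧ (∀ t, s(c t, c (t + 1)) ∈ p.edges) ∧
      ∀ v ∈ p.support, ∃ t, c t = v := by
  have h3 := hp.three_le_length
  have hpos : (0 : ℤ) < p.length := by omega
  let c : ℤ → V := fun t => p.getVert (t % p.length).toNat
  have hmod : ∀ t : ℤ, (t % p.length).toNat < p.length := by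
    intro t
    have := Int.emod_nonneg t hpos.ne'
    have := Int.emod_lt_of_pos t hpos
    omega
  have hsucc : ∀ t, c (t + 1) = p.getVert ((t % p.length).toNat + 1) := by
    intro t
    simp only [c]
    have h₁ := Int.emod_nonneg t hpos.ne'
    rw [← Int.emod_add_emod]
    rcases (Nat.succ_le_of_lt (hmod t)).lt_or_eq with h | h
    · rw [Int.emod_eq_of_lt (by omega) (by omega)]
      congr 1
      omega
    · rw [show t % p.length + 1 = p.length by omega, Int.emod_self, ← Nat.succ_eq_add_one, h,
        Walk.getVert_length]
      simp
  refine ⟨c, fun t => by simp [c], fun t => ?_, fun s t h => ?_, fun t => ?_, fun v hv => ?_⟩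
  · rw [hsucc]
    exact p.adj_getVert_succ (hmod t)
  · have h₁ := hmod s
    have h₂ := hmod t
    have h₃ := hp.getVert_injOn' (Nat.le_sub_one_of_lt h₁) (Nat.le_sub_one_of_lt h₂) h
    have h₄ := Int.emod_nonneg s hpos.ne'
    have h₅ := Int.emod_nonneg t hpos.ne'
    exact Int.ModEq.dvd (show s % _ = t % _ by omega)
  · rw [hsucc]
    exact p.mk_mem_edges_iff_exists.2 ⟨_, hmod t, rfl⟩
  · obtain ⟨n, rfl, hn⟩ := Walk.mem_support_iff_exists_getVert.1 hv
    rcases hn.lt_or_eq with h | rfl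
    · exact ⟨n, by simp [c, Int.emod_eq_of_lt (Int.natCast_nonneg n) (Int.ofNat_lt.2 h)]⟩
    · exact ⟨0, by simp [c]⟩

end Detour

section Main

variable {V : Type*} [LinearOrder V] {G : SimpleGraph V}

lemma exists_energy_pos_of_hasDetour (hG : G.Connected)
    (h : ∃ (u : V) (p : G.Walk u u), p.IsCycle ∧ p.HasDetour) :
    ∃ ω : SubdivVert V 180 G →₀ ℝ, (∑ x ∈ ω.support, ω x) = 0 ∧
      0 < ∑ x ∈ ω.support, ∑ y ∈ ω.support,
          ω x * ω y * ((G.subdivision 180).dist x y : ℝ) := by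
  classical
  have hex : ∃ m, ∃ (u : V) (p : G.Walk u u), p.length = m ∧ p.IsCycle ∧ p.HasDetour := by
    obtain ⟨u, p, hp⟩ := h
    exact ⟨_, u, p, rfl, hp⟩
  obtain ⟨u, p, hl, hp, x, hx, y, hy, hxy, hreach⟩ := Nat.find_spec hex
  obtain ⟨c, hper, hadj, hinj, hedge, hsurj⟩ := Walk.exists_int_of_isCycle hp
  have hmin : ∀ (v : V) (q : G.Walk v v), q.IsCycle → q.HasDetour → p.length ≤ q.length :=
    fun v q hq hq' => hl ▸ Nat.find_min' hex ⟨v, q, rfl, hq, hq'⟩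
  have hiso := dist_eq_of_forall_isCycle_le_length hG hp.three_le_length hper hadj hinj hmin
  obtain ⟨s, rfl⟩ := hsurj x hx
  obtain ⟨t, rfl⟩ := hsurj y hy
  refine exists_energy_pos_of_isometric_cycle hG hp.three_le_length (c := fun r => c (s + r))
    (t₀ := t - s) (fun r => ?_) (fun r => ?_) (fun r n hn => ?_) (by simpa using hxy) ?_
  · simp only
    rw [← add_assoc, hper]
  · simpa only [add_assoc] using hadj (s + r)
  · simpa only [add_assoc] using hiso (s + r) n hn
  · simp only [add_zero, add_sub_cancel]
    refine hreach.mono (deleteEdges_anti ?_)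
    rintro _ ⟨r, rfl⟩
    have := hedge (s + r)
    rw [add_assoc] at this
    exact this

end Main

section Minor

variable {V : Type*} {G : SimpleGraph V}

lemma exists_isPath_of_connected_induce {S : Set V} (hS : (G.induce S).Connected) {x y : V}
    (hx : x ∈ S) (hy : y ∈ S) : ∃ p : G.Walk x y, p.IsPath ∧ ∀ z ∈ p.support, z ∈ S := by
  obtain ⟨p, hp⟩ := (hS.preconnected ⟨x, hx⟩ ⟨y, hy⟩).exists_isPath
  refine ⟨p.map (Embedding.induce S).toHom, hp.map Subtype.val_injective, ?_⟩
  intro z hz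
  obtain ⟨w, -, rfl⟩ := List.mem_map.1
    ((congrArg (z ∈ ·) (Walk.support_map (Embedding.induce S).toHom p)).mp hz)
  exact w.2

lemma exists_isPath_of_connected_induce_of_adj {S T : Set V} (hS : (G.induce S).Connected)
    (hT : (G.induce T).Connected) (hST : Disjoint S T) {x s t y : V} (hx : x ∈ S) (hs : s ∈ S)
    (ht : t ∈ T) (hy : y ∈ T) (hst : G.Adj s t) :
    ∃ p : G.Walk x y, p.IsPath ∧ ∀ z ∈ p.support, z ∈ S ∪ T := by
  obtain ⟨p, hp, hpS⟩ := exists_isPath_of_connected_induce hS hx hs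
  obtain ⟨q, hq, hqT⟩ := exists_isPath_of_connected_induce hT ht hy
  refine ⟨p.append (Walk.cons hst q), ?_, fun z hz => ?_⟩
  · rw [Walk.isPath_def, Walk.support_append, Walk.support_cons, List.tail_cons,
      List.nodup_append']
    exact ⟨hp.support_nodup, hq.support_nodup,
      fun z hz hz' => Set.disjoint_left.1 hST (hpS z hz) (hqT z hz')⟩
  · rw [Walk.support_append, Walk.support_cons, List.tail_cons, List.mem_append] at hz
    exact hz.imp (hpS z) (hqT z)

lemma Walk.reachable_deleteEdges_or_exists {S : Set V} {E : Set (Sym2 V)}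
    (hE : ∀ x y, s(x, y) ∈ E → y ∈ S) {x y : V} (p : G.Walk x y) :
    (G.deleteEdges E).Reachable x y ∨ ∃ z ∈ S, z ∈ p.support ∧ (G.deleteEdges E).Reachable z y := by
  induction p with
  | nil => exact Or.inl (Reachable.refl _)
  | @cons u v w h p ih =>
    rcases ih with ih | ⟨z, hz, hzp, ih⟩
    · by_cases huv : s(u, v) ∈ E
      · exact Or.inr ⟨v, hE _ _ huv, by simp, ih⟩
      · exact Or.inl ((deleteEdges_adj.2 ⟨h, huv⟩ : (G.deleteEdges E).Adj u v).reachable.trans ih)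
    · exact Or.inr ⟨z, hz, by simp [hzp], ih⟩

lemma exists_hasDetour_of_branchSets {B₀ B₁ D₀ D₁ D₂ : Set V} (hB₀ : (G.induce B₀).Connected)
    (hB₁ : (G.induce B₁).Connected) (hD₀ : (G.induce D₀).Connected)
    (hD₁ : (G.induce D₁).Connected) (hD₂ : (G.induce D₂).Connected)
    (hBB : Disjoint B₀ B₁) (hB₀D₀ : Disjoint B₀ D₀) (hB₀D₁ : Disjoint B₀ D₁)
    (hB₀D₂ : Disjoint B₀ D₂) (hB₁D₀ : Disjoint B₁ D₀) (hB₁D₁ : Disjoint B₁ D₁)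
    (hB₁D₂ : Disjoint B₁ D₂) (hD₀D₁ : Disjoint D₀ D₁) (hD₀D₂ : Disjoint D₀ D₂)
    (hD₁D₂ : Disjoint D₁ D₂)
    (h₀₀ : ∃ a ∈ B₀, ∃ b ∈ D₀, G.Adj a b) (h₀₁ : ∃ a ∈ B₀, ∃ b ∈ D₁, G.Adj a b)
    (h₀₂ : ∃ a ∈ B₀, ∃ b ∈ D₂, G.Adj a b) (h₁₀ : ∃ a ∈ B₁, ∃ b ∈ D₀, G.Adj a b)
    (h₁₁ : ∃ a ∈ B₁, ∃ b ∈ D₁, G.Adj a b) (h₁₂ : ∃ a ∈ B₁, ∃ b ∈ D₂, G.Adj a b) :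
    ∃ (u : V) (p : G.Walk u u), p.IsCycle ∧ p.HasDetour := by
  rw [Set.disjoint_left] at *
  obtain ⟨a, ha, d, hd, had⟩ := h₀₀
  obtain ⟨u, hu, e', he', hue⟩ := h₀₁
  obtain ⟨a₂, ha₂, f, hf, haf⟩ := h₀₂
  obtain ⟨v, hv, d', hd', hvd⟩ := h₁₀
  obtain ⟨b, hb, e, he, hbe⟩ := h₁₁
  obtain ⟨b₂, hb₂, f', hf', hbf⟩ := h₁₂
  obtain ⟨p, hp, hpS⟩ := exists_isPath_of_connected_induce_of_adj hB₀ hD₀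
    (Set.disjoint_left.2 hB₀D₀) hu ha hd hd' had
  obtain ⟨q, hq, hqS⟩ := exists_isPath_of_connected_induce_of_adj hB₁ hD₁
    (Set.disjoint_left.2 hB₁D₁) hv hb he he' hbe
  have hvp : v ∉ p.support := fun h => (hpS v h).elim (fun h => hBB h hv) (hB₁D₀ hv)
  have huq : u ∉ q.support := fun h => (hqS u h).elim (hBB hu) (hB₀D₁ hu)
  have hpq : ∀ z ∈ p.support, z ∉ q.support := by
    intro z hz hz'
    rcases hpS z hz with h | h <;> rcases hqS z hz' with h' | h'
    exacts [hBB h h', hB₀D₁ h h', hB₁D₀ h' h, hD₀D₁ h h']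
  have hlen : 0 < p.length := by
    refine Nat.pos_of_ne_zero fun h => ?_
    exact hB₀D₀ hu (Walk.eq_of_length_eq_zero h ▸ hd')
  obtain ⟨C, hC, hCS, huC, hvC⟩ : ∃ C : G.Walk u u, C.IsCycle ∧
      (∀ z ∈ C.support, z ∈ p.support ∨ z ∈ q.support) ∧ u ∈ C.support ∧ v ∈ C.support := by
    refine ⟨(p.concat hvd.symm).append (q.concat hue.symm),
      (hp.concat hvp hvd.symm).isCycle_append (hq.concat huq hue.symm) ?_ (Or.inl ?_), ?_, ?_, ?_⟩
    · have hp' := hp.support_nodup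
      have hq' := hq.support_nodup
      intro z hz hz'
      rw [← Walk.cons_tail_support, List.nodup_cons] at hp' hq'
      rw [Walk.support_concat, ← Walk.cons_tail_support, List.cons_append, List.tail_cons,
        List.mem_append, List.mem_singleton] at hz hz'
      rcases hz with hz | rfl <;> rcases hz' with hz' | rfl
      · exact hpq _ (List.mem_of_mem_tail hz) (List.mem_of_mem_tail hz')
      · exact hp'.1 hz
      · exact hq'.1 hz'
      · exact hBB hu hv
    · rw [Walk.length_concat]
      omega
    · intro z hz
      rw [Walk.mem_support_append_iff, Walk.support_concat, Walk.support_concat, List.mem_append,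
        List.mem_append, List.mem_singleton, List.mem_singleton] at hz
      rcases hz with (hz | rfl) | (hz | rfl)
      exacts [Or.inl hz, Or.inr q.start_mem_support, Or.inr hz, Or.inl p.start_mem_support]
    · exact Walk.start_mem_support _
    · rw [Walk.mem_support_append_iff]
      exact Or.inl (Walk.end_mem_support _)
  refine ⟨u, C, hC, ?_⟩
  have hCD : ∀ z ∈ D₂, z ∉ C.support := by
    intro z hz hzC
    rcases hCS z hzC with h | h
    · exact (hpS z h).elim (fun h => hB₀D₂ h hz) (fun h => hD₀D₂ h hz)
    · exact (hqS z h).elim (fun h => hB₁D₂ h hz) (fun h => hD₁D₂ h hz)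
  have hend : ∀ {S : Set V}, (G.induce S).Connected → ∀ {x y}, x ∈ S → y ∈ S → x ∈ C.support →
      ∃ z ∈ S, z ∈ C.support ∧ (G.deleteEdges {e | e ∈ C.edges}).Reachable z y := by
    intro S hS x y hx hy hxC
    obtain ⟨r, -, hr⟩ := exists_isPath_of_connected_induce hS hx hy
    rcases r.reachable_deleteEdges_or_exists (S := {z | z ∈ C.support})
      (E := {e | e ∈ C.edges}) (fun _ _ h => C.snd_mem_support_of_mem_edges h)
      with h | ⟨z, hz, hzr, h⟩
    · exact ⟨x, hx, hxC, h⟩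
    · exact ⟨z, hr z hzr, hz, h⟩
  obtain ⟨x, hx, hxC, hxr⟩ := hend hB₀ hu ha₂ huC
  obtain ⟨y, hy, hyC, hyr⟩ := hend hB₁ hv hb₂ hvC
  obtain ⟨r, -, hr⟩ := exists_isPath_of_connected_induce hD₂ hf hf'
  have hrr : (G.deleteEdges {e | e ∈ C.edges}).Reachable f f' := by
    refine ⟨r.toDeleteEdges _ fun e he heC => ?_⟩
    induction e with
    | _ z z' =>
      exact hCD z (hr z (r.fst_mem_support_of_mem_edges he)) (C.fst_mem_support_of_mem_edges heC)
  have hadj : ∀ {z z'}, G.Adj z z' → z' ∈ D₂ → (G.deleteEdges {e | e ∈ C.edges}).Adj z z' :=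
    fun h hz' => deleteEdges_adj.2 ⟨h, fun hC => hCD _ hz' (C.snd_mem_support_of_mem_edges hC)⟩
  exact ⟨x, hxC, y, hyC, fun h => hBB hx (h ▸ hy), hxr.trans <|
    (hadj haf hf).reachable.trans <| hrr.trans <| (hadj hbf hf').symm.reachable.trans hyr.symm⟩

lemma HasMinor.exists_hasDetour
    (h : G.HasMinor (completeBipartiteGraph (Fin 2) (Fin 3))) :
    ∃ (u : V) (p : G.Walk u u), p.IsCycle ∧ p.HasDetour := by
  obtain ⟨B, hB, hdisj, hadj⟩ := h
  have hl : ∀ i j, Disjoint (B (Sum.inl i)) (B (Sum.inr j)) := fun i j => hdisj (by simp)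
  have hr : ∀ i j, i ≠ j → Disjoint (B (Sum.inr i)) (B (Sum.inr j)) :=
    fun i j hij => hdisj (by simpa using hij)
  have he : ∀ i j, ∃ a ∈ B (Sum.inl i), ∃ b ∈ B (Sum.inr j), G.Adj a b :=
    fun i j => hadj _ _ (by simp)
  exact exists_hasDetour_of_branchSets (hB (Sum.inl 0)) (hB (Sum.inl 1)) (hB (Sum.inr 0))
    (hB (Sum.inr 1)) (hB (Sum.inr 2)) (hdisj (by simp)) (hl _ _) (hl _ _) (hl _ _) (hl _ _)
    (hl _ _) (hl _ _) (hr _ _ (by decide)) (hr _ _ (by decide)) (hr _ _ (by decide)) (he _ _)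
    (he _ _) (he _ _) (he _ _) (he _ _) (he _ _)

end Minor

end SimpleGraph

/-- if a finite connected simple graph `G` contains `K_{2,3}` as a minor,
then the shortest-path metric of the `180`-subdivision of `G` does not have negative
type: there is a finitely supported `ω` on its vertices with total sum `0` and positive
energy `∑ ω(x) ω(y) dist(x,y)`. -/
theorem subdivision_180_not_negative_type
    (V : Type*) [Fintype V] [LinearOrder V] (G : SimpleGraph V)
    (hconn : G.Connected)
    (hminor : G.HasMinor (completeBipartiteGraph (Fin 2) (Fin 3))) :
    ∃ ω : SubdivVert V 180 G →₀ ℝ,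
      (∑ x ∈ ω.support, ω x) = 0 ∧
      0 < ∑ x ∈ ω.support, ∑ y ∈ ω.support,
          ω x * ω y * ((G.subdivision 180).dist x y : ℝ) := by
  exact SimpleGraph.exists_energy_pos_of_hasDetour hconn hminor.exists_hasDetour
end

section
/- Let G' be the 2-subdivision of the complete graph K₄ (a graph on 16 vertices: the four branch vertices of K₄ together with two subdivision vertices on each of the six edges), and let dist be its shortest-path metric. Then the finite metric space (V(G'), dist) is ℓ₁-embeddable. -/
/-- The complete graph `K₄` on four vertices. -/
abbrev K4 : SimpleGraph (Fin 4) := ⊤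

/-- A function `D` which vanishes on the diagonal, changes by at most `c` along edges and can be
decreased by exactly `c` along some edge off the diagonal is `c` times the graph metric. -/
theorem SimpleGraph.eq_mul_dist_of_local {V : Type*} {G : SimpleGraph V} {c : ℕ} (hc : 0 < c)
    (D : V → V → ℕ) (hself : ∀ v, D v v = 0)
    (hadj : ∀ u w v, G.Adj u w → D u v ≤ D w v + c)
    (hstep : ∀ u v, u ≠ v → ∃ w, G.Adj u w ∧ D u v = D w v + c) (u v : V) :
    D u v = c * G.dist u v := by
  have hle {u v : V} (p : G.Walk u v) : D u v ≤ c * p.length := by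
    induction p with
    | nil => simp [hself]
    | cons h p ih =>
      rw [SimpleGraph.Walk.length_cons, mul_add, mul_one]
      exact (hadj _ _ _ h).trans (by gcongr)
  have hwalk (n : ℕ) : ∀ u v, D u v = n → ∃ p : G.Walk u v, D u v = c * p.length := by
    induction n using Nat.strong_induction_on with
    | _ n ih =>
      intro u v hn
      by_cases huv : u = v
      · subst huv
        exact ⟨.nil, by simp [hself]⟩
      · obtain ⟨w, hw, hD⟩ := hstep u v huv
        obtain ⟨p, hp⟩ := ih (D w v) (by omega) w v rfl
        exact ⟨.cons hw p, by rw [hD, hp, SimpleGraph.Walk.length_cons, mul_add, mul_one]⟩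
  obtain ⟨p, hp⟩ := hwalk _ u v rfl
  obtain ⟨q, hq⟩ := p.reachable.exists_walk_length_eq_dist
  refine le_antisymm (hq ▸ hle q) ?_
  rw [hp]
  exact Nat.mul_le_mul_left c (SimpleGraph.dist_le p)

instance {V : Type*} [LinearOrder V] (k : ℕ) (G : SimpleGraph V) [DecidableRel G.Adj] :
    DecidableRel (G.subdivision k).Adj := fun x y => by
  refine @decidable_of_iff' _ _ (SimpleGraph.fromRel_adj _ x y) ?_
  rcases x with a | ⟨e, i⟩ <;> rcases y with b | ⟨f, j⟩ <;> dsimp only <;> infer_instance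

/-- The side of the cut indexed by `(a, d)` containing `a`: it consists of `a` and the subdivision
vertices on the edges at `a`, except for the one next to `d`. -/
def cutSide (a d : Fin 4) : SubdivVert (Fin 4) 2 K4 → Bool
  | Sum.inl x => x = a
  | Sum.inr (e, i) =>
      let near := if i = 0 then e.1.1 else e.1.2
      let far := if i = 0 then e.1.2 else e.1.1
      near = a ∨ (far = a ∧ near ≠ d)

/-- The cut indexed by `i`, which runs through the ordered pairs of distinct vertices of `K₄`. -/
def cut (i : Fin 12) : SubdivVert (Fin 4) 2 K4 → Bool :=
  let p := (finProdFinEquiv (m := 4) (n := 3)).symm i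
  cutSide p.1 (p.1.succAbove p.2)

/-- The number of cuts separating two vertices. -/
def cutDist (u v : SubdivVert (Fin 4) 2 K4) : ℕ :=
  ∑ i, if cut i u = cut i v then 0 else 1

set_option synthInstance.maxSize 1000 in
theorem cutDist_eq_two_mul_dist (u v : SubdivVert (Fin 4) 2 K4) :
    cutDist u v = 2 * (K4.subdivision 2).dist u v := by
  refine SimpleGraph.eq_mul_dist_of_local two_pos cutDist (fun v => by simp [cutDist]) ?_ ?_ u v
  · have hedge : ∀ u w, (K4.subdivision 2).Adj u w → cutDist u w ≤ 2 := by decide +kernel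
    intro u w v h
    have htri : cutDist u v ≤ cutDist w v + cutDist u w := by
      simp only [cutDist, ← Finset.sum_add_distrib]
      exact Finset.sum_le_sum fun i _ => by grind
    exact htri.trans (Nat.add_le_add_left (hedge u w h) _)
  · decide +kernel

/-- the shortest-path metric of the `2`-subdivision of `K₄`
(a graph on 16 vertices) is `ℓ₁`-embeddable. -/
theorem two_subdivision_K4_l1_embeddable :
    ∃ (m : ℕ) (g : SubdivVert (Fin 4) 2 K4 → Fin m → ℝ),
      ∀ u v : SubdivVert (Fin 4) 2 K4,
        ((K4.subdivision 2).dist u v : ℝ) = ∑ i, |g u i - g v i| := by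
  refine ⟨12, fun v i => if cut i v then 1 / 2 else 0, fun u v => ?_⟩
  have h : (cutDist u v : ℝ) = 2 * (K4.subdivision 2).dist u v := by
    exact_mod_cast cutDist_eq_two_mul_dist u v
  have hcut : ∑ i, |(if cut i u then 1 / 2 else 0 : ℝ) - if cut i v then 1 / 2 else 0| =
      1 / 2 * (cutDist u v : ℝ) := by
    rw [cutDist, Nat.cast_sum, Finset.mul_sum]
    refine Finset.sum_congr rfl fun i _ => ?_
    cases cut i u <;> cases cut i v <;> norm_num
  rw [hcut, h]
  ring
end

section
/- Let G' be the 2-subdivision of the complete graph K₄ with branch vertices x₁, x₂, x₃, x₄, and let dist be its shortest-path metric. For distinct i, j ∈ {1,2,3,4}, let S_{i,j} be the set consisting of x_i together with all vertices of G' that are within distance 2 of x_i and are not adjacent to x_j. Then 2·dist(u,v) = ∑_{i≠j} d_{S_{i,j}}(u,v) for all vertices u, v of G', where the sum ranges over all 12 ordered pairs of distinct indices i, j ∈ {1,2,3,4}. -/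
open Classical in
/-- The cut (semi)metric of a vertex set `S`: `d_S(u,v) = 1` if exactly one of `u`, `v`
lies in `S`, and `0` otherwise. -/
noncomputable def cutMetric {α : Type*} (S : Set α) (u v : α) : ℝ :=
  if (u ∈ S) ↔ (v ∈ S) then 0 else 1

/-- The branch vertex `xᵢ` of the `2`-subdivision of `K₄`. -/
abbrev K4branch (i : Fin 4) : SubdivVert (Fin 4) 2 K4 := Sum.inl i

/-- For distinct `i, j`, the set `S_{i,j}`: the branch vertex `xᵢ` together with all
vertices of the `2`-subdivision of `K₄` within distance `2` of `xᵢ` that are not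
adjacent to `xⱼ`. -/
def cutSet (i j : Fin 4) : Set (SubdivVert (Fin 4) 2 K4) :=
  {v | v = K4branch i ∨
    ((K4.subdivision 2).dist v (K4branch i) ≤ 2 ∧ ¬ (K4.subdivision 2).Adj v (K4branch j))}

/-- A function to `ℕ` vanishing only at `v`, growing by at most one along edges, and
decreasing along some edge at every vertex other than `v`, is the distance to `v`. -/
theorem SimpleGraph.dist_eq_of_potential {V : Type*} {G : SimpleGraph V} {v : V} {f : V → ℕ}
    (hv : ∀ u, f u = 0 ↔ u = v) (hstep : ∀ u w, G.Adj u w → f u ≤ f w + 1)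
    (hdesc : ∀ u, f u ≠ 0 → ∃ w, G.Adj u w ∧ f w + 1 = f u) (u : V) : G.dist u v = f u := by
  have hlower : ∀ {a b : V} (p : G.Walk a b), f a ≤ f b + p.length := by
    intro a b p
    induction p with
    | nil => simp
    | cons h p ih =>
      have := hstep _ _ h
      rw [SimpleGraph.Walk.length_cons]
      omega
  have hupper : ∀ n a, f a = n → ∃ p : G.Walk a v, p.length = n := by
    intro n
    induction n with
    | zero =>
      intro a ha
      obtain rfl := (hv a).1 ha
      exact ⟨.nil, rfl⟩
    | succ n ih =>
      intro a ha
      obtain ⟨w, haw, hw⟩ := hdesc a (by omega)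
      obtain ⟨p, hp⟩ := ih w (by omega)
      exact ⟨.cons haw p, by rw [SimpleGraph.Walk.length_cons, hp]⟩
  obtain ⟨p, hp⟩ := hupper _ u rfl
  obtain ⟨q, hq⟩ := p.reachable.exists_walk_length_eq_dist
  refine le_antisymm (hp ▸ SimpleGraph.dist_le p) ?_
  have := hlower q
  rw [(hv v).2 rfl] at this
  omega

instance decidableRelSubdivisionAdj {V : Type*} [LinearOrder V] (k : ℕ) (G : SimpleGraph V)
    [DecidableRel G.Adj] : DecidableRel (G.subdivision k).Adj := fun x y =>
  @decidable_of_iff _ _ (SimpleGraph.fromRel_adj _ x y).symm (by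
    rcases x with a | ⟨e, i⟩ <;> rcases y with b | ⟨e', i'⟩ <;>
      refine @instDecidableAnd _ _ inferInstance (@instDecidableOr _ _ ?_ ?_) <;>
      dsimp only <;> infer_instance)

/-- The distance from a vertex of the `2`-subdivision of `K₄` to the branch vertex `xᵢ`. -/
def K4branchDist (i : Fin 4) : SubdivVert (Fin 4) 2 K4 → ℕ
  | Sum.inl a => if a = i then 0 else 3
  | Sum.inr (e, k) => if i = e.1.1 then k + 1 else if i = e.1.2 then 2 - k else 4

/-- An explicit formula for the distance in the `2`-subdivision of `K₄`: a shortest path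
passes through a branch vertex unless it stays in the interior of a subdivided edge. -/
def K4subdivDist (u v : SubdivVert (Fin 4) 2 K4) : ℕ :=
  let viaBranch := Finset.univ.inf' Finset.univ_nonempty
    fun i : Fin 4 => K4branchDist i u + K4branchDist i v
  match u, v with
  | Sum.inr (e, k), Sum.inr (e', k') => if e = e' then Nat.dist k k' else viaBranch
  | _, _ => viaBranch

theorem K4_subdivision_dist (u v : SubdivVert (Fin 4) 2 K4) :
    (K4.subdivision 2).dist u v = K4subdivDist u v := by
  refine SimpleGraph.dist_eq_of_potential (f := fun u => K4subdivDist u v) ?_ ?_ ?_ u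
  · revert v
    decide +kernel
  · revert v
    decide +kernel
  · revert v
    decide +kernel

theorem mem_cutSet_iff (i j : Fin 4) (v : SubdivVert (Fin 4) 2 K4) :
    v ∈ cutSet i j ↔ v = K4branch i ∨
      (K4subdivDist v (K4branch i) ≤ 2 ∧ ¬ (K4.subdivision 2).Adj v (K4branch j)) := by
  rw [← K4_subdivision_dist]
  rfl

instance decidableMemCutSet (i j : Fin 4) (v : SubdivVert (Fin 4) 2 K4) :
    Decidable (v ∈ cutSet i j) :=
  decidable_of_iff _ (mem_cutSet_iff i j v).symm

theorem cutMetric_eq_natCast {α : Type*} (S : Set α) [DecidablePred (· ∈ S)] (u v : α) :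
    cutMetric S u v = ((if u ∈ S ↔ v ∈ S then 0 else 1 : ℕ) : ℝ) := by
  unfold cutMetric
  split_ifs <;> simp

theorem two_mul_K4subdivDist : ∀ u v : SubdivVert (Fin 4) 2 K4,
    2 * K4subdivDist u v = ∑ i : Fin 4, ∑ j : Fin 4,
      if i ≠ j then (if u ∈ cutSet i j ↔ v ∈ cutSet i j then 0 else 1) else 0 := by
  decide +kernel

/-- twice the shortest-path metric of the `2`-subdivision of `K₄` equals
the sum of the cut metrics `d_{S_{i,j}}` over all 12 ordered pairs of distinct indices
`i, j ∈ {1,2,3,4}`. -/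
theorem two_subdivision_K4_cut_decomposition :
    ∀ u v : SubdivVert (Fin 4) 2 K4,
      2 * ((K4.subdivision 2).dist u v : ℝ) =
        ∑ i : Fin 4, ∑ j : Fin 4, if i ≠ j then cutMetric (cutSet i j) u v else 0 := by
  intro u v
  simp only [cutMetric_eq_natCast, K4_subdivision_dist]
  exact_mod_cast two_mul_K4subdivDist u v
end

section
/- Let (M,d) be a metric space and let y₁, y₂, y₃, z₁, z₂, z₃ ∈ M satisfy d(y₁,y₂) = d(y₂,y₃) = d(z₁,z₂) = d(z₂,z₃) = 1/12, d(y₁,y₃) = d(z₁,z₃) = 1/6, and d(y₂,z₂) = 1/6 + min( d(y₁,z₁), d(y₁,z₃), d(y₃,z₁), d(y₃,z₃) ). Then there exists i ∈ {1,2} such that d(y_i,z_i) + d(y_{i+1},z_{i+1}) ≥ d(y_i,z_{i+1}) + d(y_{i+1},z_i). -/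
/-- if `y₁, y₂, y₃` and `z₁, z₂, z₃` are points of a metric space with
`d(y₁,y₂) = d(y₂,y₃) = d(z₁,z₂) = d(z₂,z₃) = 1/12`, `d(y₁,y₃) = d(z₁,z₃) = 1/6`, and
`d(y₂,z₂) = 1/6 + min(d(y₁,z₁), d(y₁,z₃), d(y₃,z₁), d(y₃,z₃))`, then for some
`i ∈ {1,2}` we have `d(yᵢ,zᵢ) + d(yᵢ₊₁,zᵢ₊₁) ≥ d(yᵢ,zᵢ₊₁) + d(yᵢ₊₁,zᵢ)`. -/
theorem quadrilateral_choice
    (M : Type*) [MetricSpace M] (y₁ y₂ y₃ z₁ z₂ z₃ : M)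
    (hy12 : dist y₁ y₂ = 1 / 12) (hy23 : dist y₂ y₃ = 1 / 12)
    (hz12 : dist z₁ z₂ = 1 / 12) (hz23 : dist z₂ z₃ = 1 / 12)
    (hy13 : dist y₁ y₃ = 1 / 6) (hz13 : dist z₁ z₃ = 1 / 6)
    (hmid : dist y₂ z₂ = 1 / 6 +
      min (min (dist y₁ z₁) (dist y₁ z₃)) (min (dist y₃ z₁) (dist y₃ z₃))) :
    (dist y₁ z₁ + dist y₂ z₂ ≥ dist y₁ z₂ + dist y₂ z₁) ∨
    (dist y₂ z₂ + dist y₃ z₃ ≥ dist y₂ z₃ + dist y₃ z₂) := by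
  have hy21 := dist_comm y₁ y₂
  have hz32 := dist_comm z₂ z₃
  rcases min_choice (min (dist y₁ z₁) (dist y₁ z₃)) (min (dist y₃ z₁) (dist y₃ z₃)) with h | h <;>
    rw [h] at hmid
  · left
    rcases min_choice (dist y₁ z₁) (dist y₁ z₃) with h' | h' <;> rw [h'] at hmid
    · linarith [dist_triangle y₁ z₁ z₂, dist_triangle y₂ y₁ z₁]
    · linarith [dist_triangle y₁ z₃ z₂, dist_triangle y₂ y₁ z₁]
  · rcases min_choice (dist y₃ z₁) (dist y₃ z₃) with h' | h' <;> rw [h'] at hmid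
    · left
      linarith [dist_triangle y₂ y₃ z₁, dist_triangle y₁ z₁ z₂]
    · right
      linarith [dist_triangle y₂ y₃ z₃, dist_triangle y₃ z₃ z₂]
end
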